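/- arXiv:2103.16374 — 3 statements merged into one kernel-verified Lean document; each statement's English description precedes it below -/
import Mathlib

section
/- Explicit λ-action on Verma modules: for sequences I, L of distinct indices in {1,2,3,4} and v ∈ F, ξ_I λ (η_L⊗v) = (−1)^{|I|}(|I|−2)Θ ∂_I η_L⊗v + Σ_{i=1}^4 ∂_{(∂_iξ_I)}(ξ_i⋆η_L)⊗v + (−1)^{|I|} Σ_{i<j} ∂_{(∂_{ij}ξ_I)}η_L ⊗ ξ_{j,i}.v + χ_{|I|=3} ε_I ∂_{I^c}η_L ⊗ Cv + λ[ (−1)^{|I|}∂_I η_L ⊗ t.v + (−1)^{|I|+|L|} Σ_{i=1}^4 (∂_{Ii}η_L ⋆ ξ_i)⊗v + Σ_{i≠j} ∂_{∂_iξ_I}(∂_j η_L) ⊗ ξ_{j,i}.v + χ_{|I|=2} ε_I ∂_{I^c}η_L ⊗ Cv ] + λ^2[ (−1)^{|I|} Σ_{i<j} ∂_{Iij}η_L ⊗ ξ_{j,i}.v − χ_{|I|=1} ε_I ∂_{I^c}η_L ⊗ Cv ] + λ^3[ −χ_{|I|=0} ∂_{I^c}η_L ⊗ Cv ]. -/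
/-!
Core definitions modelling the annihilation superalgebra `𝔤 = 𝒜(K'₄) = K(1,4)₊ ⊕ ℂC`
and generalized Verma modules `Ind F ≅ ℂ[Θ] ⊗ Λ(η₁,…,η₄) ⊗ F` over it.

Grassmann monomials `ξ_I`/`η_I` (with `I` in increasing order) are indexed by
`Idx = Finset (Fin 4)`.
-/

open Finset

noncomputable section

/-- Index set of a Grassmann monomial in `ξ₁,…,ξ₄` (0-indexed). -/
abbrev Idx : Type := Finset (Fin 4)

/-- Sign appearing when multiplying two Grassmann monomials: `ξ_I ξ_J = msign I J • ξ_{I ∪ J}`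
(for `I, J` disjoint). -/
def msign (I J : Idx) : ℤ := (-1 : ℤ) ^ ((I ×ˢ J).filter (fun p => p.2 < p.1)).card

/-- Sign of `∂ᵢ ξ_I` (for `i ∈ I`): `∂ᵢ ξ_I = dsign i I • ξ_{I \ {i}}`. -/
def dsign (i : Fin 4) (I : Idx) : ℤ := (-1 : ℤ) ^ (I.filter (fun j => j < i)).card

/-- Sign of the iterated derivative `∂_S η_L = ∂_{s₁} ⋯ ∂_{s_k} η_L` (`s₁ < ⋯ < s_k`,
`S ⊆ L`): `∂_S η_L = ddsign S L • η_{L \ S}`. -/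
def ddsign (S L : Idx) : ℤ :=
  (-1 : ℤ) ^ (S.card * (S.card - 1) / 2) *
    (-1 : ℤ) ^ (∑ i ∈ S, ((L \ S).filter (fun j => j < i)).card)

/-- `epsSign I` is the sign `ε_I` of the permutation `(I, Iᶜ)` of `(1,2,3,4)`. -/
def epsSign (I : Idx) : ℤ := msign I Iᶜ

variable (F : Type*) [AddCommGroup F] [Module ℂ F]

/-- The generalized Verma module `Ind F = ℂ[Θ] ⊗ Λ(η₁,…,η₄) ⊗ F`,
with `(k, L)`-component the coefficient of `Θ^k η_L`. -/
abbrev VInd : Type _ := (ℕ × Idx) →₀ F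

variable {F}

/-- Basis-type element `Θ^k η_L ⊗ v` of `Ind F`. -/
def bv (k : ℕ) (L : Idx) (v : F) : VInd F := Finsupp.single (k, L) v

/-- Action of the central element `C` on `Ind F`: it acts through its action `ρC` on `F`. -/
def Cop (ρC : F →ₗ[ℂ] F) : VInd F →ₗ[ℂ] VInd F := Finsupp.mapRange.linearMap ρC

/-- Multiplication by `Θ` on `Ind F`. -/
def thOp : VInd F →ₗ[ℂ] VInd F := Finsupp.lmapDomain F ℂ (fun p => (p.1 + 1, p.2))

/-- The 2-cocycle `ψ` on `K(1,4)₊` defining the central extension `𝒜(K'₄)`, evaluated on the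
basis monomials `t^0 ξ_I`, `t^0 ξ_J`: the only nonzero values are
`ψ(1, ξ₁₂₃₄) = -2`, `ψ(ξ₁₂₃₄, 1) = 2` and `ψ(ξ_i, ξ_{{i}ᶜ}) = ψ(ξ_{{i}ᶜ}, ξ_i) = -∂ᵢ-sign`
(equivalently `ψ(ξ_i, ∂ᵢξ₁₂₃₄) = -1`). -/
def psi0 (I J : Idx) : ℂ :=
  (if I = (∅ : Idx) ∧ J = (Finset.univ : Idx) then (-2 : ℂ) else 0)
  + (if I = (Finset.univ : Idx) ∧ J = (∅ : Idx) then (2 : ℂ) else 0)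
  + ∑ i : Fin 4, (if I = ({i} : Idx) ∧ J = ({i}ᶜ : Idx) then (-(dsign i Finset.univ) : ℂ) else 0)
  + ∑ i : Fin 4, (if I = ({i}ᶜ : Idx) ∧ J = ({i} : Idx) then (-(dsign i Finset.univ) : ℂ) else 0)

/-- The action on `Ind F` of the bracket `[t^m ξ_I, t^n ξ_J]` in `𝒜(K'₄) = K(1,4)₊ ⊕ ℂC`,
namely of
`(2n-2m-n|I|+m|J|) t^{m+n-1} ξ_{IJ} + (-1)^{|I|} t^{m+n} ∑ᵢ ∂ᵢξ_I ∂ᵢξ_J + ψ(t^mξ_I, t^nξ_J) C`,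
expressed through a family `act` of operators (the actions of the `t^m ξ_I`). -/
def brkAct (ρC : F →ₗ[ℂ] F) (act : ℕ → Idx → (VInd F →ₗ[ℂ] VInd F))
    (m : ℕ) (I : Idx) (n : ℕ) (J : Idx) : VInd F →ₗ[ℂ] VInd F :=
  ((2 * (n : ℤ) - 2 * (m : ℤ) - (n : ℤ) * I.card + (m : ℤ) * J.card : ℤ) : ℂ) •
      (if Disjoint I J then ((msign I J : ℤ) : ℂ) • act (m + n - 1) (I ∪ J) else 0)
  + ((-1 : ℂ) ^ I.card) • (∑ i : Fin 4,
      if i ∈ I ∧ i ∈ J ∧ Disjoint (I.erase i) (J.erase i) then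
        ((dsign i I * dsign i J * msign (I.erase i) (J.erase i) : ℤ) : ℂ) •
          act (m + n) (I.erase i ∪ J.erase i)
      else 0)
  + (if m = 0 ∧ n = 0 then psi0 I J else 0) • Cop ρC

/-- The data of a generalized Verma module over `𝒜(K'₄)`:
the action `ρt, ρC, ρξ i j` of the degree-zero part `𝔤₀ = ⟨C, t, ξ_{ij}⟩` on `F`,
and the action `act m I` of the basis elements `t^m ξ_I` of `K(1,4)₊` on
`Ind F = ℂ[Θ] ⊗ Λ(η) ⊗ F`. -/
structure VermaData (F : Type*) [AddCommGroup F] [Module ℂ F] where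
  ρt : F →ₗ[ℂ] F
  ρC : F →ₗ[ℂ] F
  ρξ : Fin 4 → Fin 4 → (F →ₗ[ℂ] F)
  act : ℕ → Idx → (VInd F →ₗ[ℂ] VInd F)

/-- The properties characterizing the generalized Verma module `Ind F` over `𝒜(K'₄)`:
* `anti` : `ξ_{ij} = -ξ_{ji}`;
* `lie`  : `act` is an action of the Lie superalgebra `𝒜(K'₄) = K(1,4)₊ ⊕ ℂC`
  (with `C` acting through `ρC`);
* `vac_pos` : the positive part `𝔤_{>0}` (spanned by the `t^m ξ_I` with `2m + |I| - 2 > 0`)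
  kills the vacuum subspace `1 ⊗ F`;
* `vac_xi`, `vac_t` : `𝔤₀` acts on `1 ⊗ F` through `ρξ`, `ρt`;
* `low_eta`, `low_one` : the negative part acts by left multiplication in
  `U(𝔤_{<0}) = ℂ[Θ] ⊗ Λ(η₁,…,η₄)` (with `η_i² = Θ` and `ξ_∅ = -2Θ`). -/
structure IsVerma (D : VermaData F) : Prop where
  anti : ∀ i j, D.ρξ i j = - D.ρξ j i
  lie : ∀ (m : ℕ) (I : Idx) (n : ℕ) (J : Idx),
      D.act m I ∘ₗ D.act n J - ((-1 : ℂ) ^ (I.card * J.card)) • (D.act n J ∘ₗ D.act m I)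
        = brkAct D.ρC D.act m I n J
  vac_pos : ∀ (v : F) (m : ℕ) (I : Idx), 2 < 2 * m + I.card → D.act m I (bv 0 ∅ v) = 0
  vac_xi : ∀ (v : F) (i j : Fin 4), i < j →
      D.act 0 {i, j} (bv 0 ∅ v) = bv 0 ∅ (D.ρξ i j v)
  vac_t : ∀ v : F, D.act 1 ∅ (bv 0 ∅ v) = bv 0 ∅ (D.ρt v)
  low_eta : ∀ (v : F) (k : ℕ) (L : Idx) (i : Fin 4),
      D.act 0 {i} (bv k L v) =
        if i ∈ L then ((dsign i L : ℤ) : ℂ) • bv (k + 1) (L.erase i) v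
        else ((msign {i} L : ℤ) : ℂ) • bv k (insert i L) v
  low_one : ∀ (v : F) (k : ℕ) (L : Idx),
      D.act 0 ∅ (bv k L v) = (-2 : ℂ) • bv (k + 1) L v

/-- A (nonzero) singular vector: a nonzero vector killed by
`𝔤_{>0} = ⟨t^m ξ_I : 2m + |I| - 2 > 0⟩`. -/
def IsSingular (D : VermaData F) (u : VInd F) : Prop :=
  u ≠ 0 ∧ ∀ (m : ℕ) (I : Idx), 2 < 2 * m + I.card → D.act m I u = 0

/-- `u` is homogeneous of degree `d` (`Θ^k η_L ⊗ v` has degree `2k + |L|`). -/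
def HomogDeg (u : VInd F) (d : ℕ) : Prop := ∀ p ∈ u.support, 2 * p.1 + p.2.card = d

/-- `u` is a highest weight vector: it is killed by the positive root vectors
`e₁ = -ξ₁₃ + i ξ₂₃` and `e₂ = -ξ₂₄ - i ξ₁₄` of `𝔤₀` (0-indexed below). -/
def IsHW (D : VermaData F) (u : VInd F) : Prop :=
  Complex.I • D.act 0 {1, 2} u - D.act 0 {0, 2} u = 0 ∧
  -(D.act 0 {1, 3} u) - Complex.I • D.act 0 {0, 3} u = 0

/-- `e₁ = e_x + e_y = -ξ₁₃ + i ξ₂₃` acting on `F`. -/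
def e1F (D : VermaData F) : F →ₗ[ℂ] F := -(D.ρξ 0 2) + Complex.I • D.ρξ 1 2

/-- `e₂ = e_x - e_y = -ξ₂₄ - i ξ₁₄` acting on `F`. -/
def e2F (D : VermaData F) : F →ₗ[ℂ] F := -(D.ρξ 1 3) - Complex.I • D.ρξ 0 3

/-- `h_x = -iξ₁₂ + iξ₃₄` acting on `F`. -/
def hxF (D : VermaData F) : F →ₗ[ℂ] F := -(Complex.I • D.ρξ 0 1) + Complex.I • D.ρξ 2 3

/-- `h_y = -iξ₁₂ - iξ₃₄` acting on `F`. -/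
def hyF (D : VermaData F) : F →ₗ[ℂ] F := -(Complex.I • D.ρξ 0 1) - Complex.I • D.ρξ 2 3

/-- `f_x = (ξ₁₃ + ξ₂₄ - iξ₁₄ + iξ₂₃)/2` acting on `F`. -/
def fxF (D : VermaData F) : F →ₗ[ℂ] F :=
  (2 : ℂ)⁻¹ • (D.ρξ 0 2 + D.ρξ 1 3 - Complex.I • D.ρξ 0 3 + Complex.I • D.ρξ 1 2)

/-- `f_y = (ξ₁₃ - ξ₂₄ + iξ₁₄ + iξ₂₃)/2` acting on `F`. -/
def fyF (D : VermaData F) : F →ₗ[ℂ] F :=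
  (2 : ℂ)⁻¹ • (D.ρξ 0 2 - D.ρξ 1 3 + Complex.I • D.ρξ 0 3 + Complex.I • D.ρξ 1 2)

/-- `v` is a highest weight vector of `F` of weight `μ = (μ.1, μ.2.1, μ.2.2.1, μ.2.2.2)`
with respect to `(h_x, h_y, t, C)`. -/
def IsHWvec (D : VermaData F) (μ : ℂ × ℂ × ℂ × ℂ) (v : F) : Prop :=
  v ≠ 0 ∧ e1F D v = 0 ∧ e2F D v = 0 ∧ hxF D v = μ.1 • v ∧ hyF D v = μ.2.1 • v ∧
    D.ρt v = μ.2.2.1 • v ∧ D.ρC v = μ.2.2.2 • v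

/-- `F` is an irreducible `𝔤₀`-module. -/
def IsIrred (D : VermaData F) : Prop :=
  (∃ v : F, v ≠ 0) ∧ ∀ p : Submodule ℂ F,
    (∀ v ∈ p, D.ρt v ∈ p ∧ D.ρC v ∈ p ∧ ∀ i j, D.ρξ i j v ∈ p) → p = ⊥ ∨ p = ⊤

/-- The commutative-in-`Θ` algebra `U(𝔤_{<0}) = ℂ[Θ] ⊗ Λ(η₁,…,η₄)` (as a ℂ-module with
basis `Θ^k η_L`). -/
abbrev CA : Type := (ℕ × Idx) →₀ ℂ

/-- Multiplication in `U(𝔤_{<0})` (`η_i² = Θ`, `Θ` central, `η_i η_j = -η_j η_i`). -/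
def cmul (x y : CA) : CA :=
  x.sum fun p c => y.sum fun q c' =>
    Finsupp.single (p.1 + q.1 + (p.2 ∩ q.2).card, (p.2 \ q.2) ∪ (q.2 \ p.2))
      (c * c' * ((msign p.2 q.2 : ℤ) : ℂ))

/-- `w₁₁ = η₂ + i η₁`. -/
def w11 : CA := Finsupp.single (0, ({1} : Idx)) 1 + Complex.I • Finsupp.single (0, ({0} : Idx)) 1
/-- `w₂₂ = η₂ - i η₁`. -/
def w22 : CA := Finsupp.single (0, ({1} : Idx)) 1 - Complex.I • Finsupp.single (0, ({0} : Idx)) 1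
/-- `w₁₂ = -η₄ + i η₃`. -/
def w12 : CA := -Finsupp.single (0, ({3} : Idx)) 1 + Complex.I • Finsupp.single (0, ({2} : Idx)) 1
/-- `w₂₁ = η₄ + i η₃`. -/
def w21 : CA := Finsupp.single (0, ({3} : Idx)) 1 + Complex.I • Finsupp.single (0, ({2} : Idx)) 1

/-- `a ⊗ v ∈ U(𝔤_{<0}) ⊗ F = Ind F`. -/
def tens (a : CA) (v : F) : VInd F := a.sum fun p c => Finsupp.single p (c • v)

end
noncomputable section
open Finset

variable {F : Type*} [AddCommGroup F] [Module ℂ F]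

/-- The Hodge-duality isomorphism `T : Ind F → Ind F`, `Θ^k η_L ⊗ v ↦ Θ^k η̄_L ⊗ v`,
where `η̄_L` is the unique monomial with `η̄_L ⋆ ξ_L = η₁₂₃₄`, i.e.
`η̄_L = msign Lᶜ L • η_{Lᶜ}`. -/
def Tmap : VInd F →ₗ[ℂ] VInd F :=
  Finsupp.lsum ℂ (fun p => ((msign p.2ᶜ p.2 : ℤ) : ℂ) • Finsupp.lsingle (p.1, p.2ᶜ))

/-- Coefficient of `λ⁰` in `ξ_I ∙_λ (η_L ⊗ v)`:
`(-1)^{|I|}(|I|-2) Θ ∂_I η_L ⊗ v + ∑ᵢ ∂_{∂ᵢξ_I}(ξᵢ ⋆ η_L) ⊗ v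
 + (-1)^{|I|} ∑_{i<j} ∂_{∂ᵢ∂ⱼξ_I} η_L ⊗ ξ_{j,i}.v + χ_{|I|=3} ε_I ∂_{Iᶜ} η_L ⊗ C v`. -/
def coef0 (D : VermaData F) (I L : Idx) (v : F) : VInd F :=
  (if I ⊆ L then
      ((((-1 : ℤ) ^ I.card * ((I.card : ℤ) - 2) * ddsign I L : ℤ)) : ℂ) • bv 1 (L \ I) v
   else 0)
  + ∑ i : Fin 4,
      (if i ∈ I ∧ i ∉ L ∧ I.erase i ⊆ insert i L then
        ((dsign i I * msign {i} L * ddsign (I.erase i) (insert i L) : ℤ) : ℂ) •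
          bv 0 (insert i L \ I.erase i) v
      else 0)
  + ∑ i : Fin 4, ∑ j : Fin 4,
      (if i < j ∧ j ∈ I ∧ i ∈ I.erase j ∧ (I.erase j).erase i ⊆ L then
        (((-1 : ℤ) ^ I.card * dsign j I * dsign i (I.erase j) *
            ddsign ((I.erase j).erase i) L : ℤ) : ℂ) •
          bv 0 (L \ (I.erase j).erase i) (D.ρξ j i v)
      else 0)
  + (if I.card = 3 ∧ Iᶜ ⊆ L then
      ((epsSign I * ddsign Iᶜ L : ℤ) : ℂ) • bv 0 (L \ Iᶜ) (D.ρC v)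
     else 0)

/-- Coefficient of `λ¹` in `ξ_I ∙_λ (η_L ⊗ v)`:
`(-1)^{|I|} ∂_I η_L ⊗ t.v + (-1)^{|I|+|L|} ∑ᵢ (∂_I ∂ᵢ η_L ⋆ ξᵢ) ⊗ v
 + ∑_{i≠j} ∂_{∂ᵢξ_I}(∂ⱼη_L) ⊗ ξ_{j,i}.v + χ_{|I|=2} ε_I ∂_{Iᶜ} η_L ⊗ C v`. -/
def coef1 (D : VermaData F) (I L : Idx) (v : F) : VInd F :=
  (if I ⊆ L then (((-1 : ℤ) ^ I.card * ddsign I L : ℤ) : ℂ) • bv 0 (L \ I) (D.ρt v) else 0)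
  + ∑ i : Fin 4,
      (if i ∈ L ∧ I ⊆ L.erase i then
        (((-1 : ℤ) ^ (I.card + L.card) * dsign i L * ddsign I (L.erase i) *
            msign ((L.erase i) \ I) {i} : ℤ) : ℂ) • bv 0 (insert i ((L.erase i) \ I)) v
      else 0)
  + ∑ i : Fin 4, ∑ j : Fin 4,
      (if i ≠ j ∧ i ∈ I ∧ j ∈ L ∧ I.erase i ⊆ L.erase j then
        ((dsign i I * dsign j L * ddsign (I.erase i) (L.erase j) : ℤ) : ℂ) •
          bv 0 ((L.erase j) \ (I.erase i)) (D.ρξ j i v)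
      else 0)
  + (if I.card = 2 ∧ Iᶜ ⊆ L then
      ((epsSign I * ddsign Iᶜ L : ℤ) : ℂ) • bv 0 (L \ Iᶜ) (D.ρC v)
     else 0)

/-- Coefficient of `λ²` in `ξ_I ∙_λ (η_L ⊗ v)`:
`(-1)^{|I|} ∑_{i<j} ∂_I ∂ᵢ ∂ⱼ η_L ⊗ ξ_{j,i}.v - χ_{|I|=1} ε_I ∂_{Iᶜ} η_L ⊗ C v`. -/
def coef2 (D : VermaData F) (I L : Idx) (v : F) : VInd F :=
  ∑ i : Fin 4, ∑ j : Fin 4,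
      (if i < j ∧ j ∈ L ∧ i ∈ L.erase j ∧ I ⊆ (L.erase j).erase i then
        (((-1 : ℤ) ^ I.card * dsign j L * dsign i (L.erase j) *
            ddsign I ((L.erase j).erase i) : ℤ) : ℂ) •
          bv 0 (((L.erase j).erase i) \ I) (D.ρξ j i v)
      else 0)
  - (if I.card = 1 ∧ Iᶜ ⊆ L then
      ((epsSign I * ddsign Iᶜ L : ℤ) : ℂ) • bv 0 (L \ Iᶜ) (D.ρC v)
     else 0)

/-- Coefficient of `λ³` in `ξ_I ∙_λ (η_L ⊗ v)`: `-χ_{|I|=0} ∂_{Iᶜ} η_L ⊗ C v`. -/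
def coef3 (D : VermaData F) (I L : Idx) (v : F) : VInd F :=
  - (if I = ∅ ∧ Iᶜ ⊆ L then ((ddsign Iᶜ L : ℤ) : ℂ) • bv 0 (L \ Iᶜ) (D.ρC v) else 0)

/-- The coefficient of `λ^m` in the `λ`-action `ξ_I ∙_λ (η_L ⊗ v)`. -/
def lamCoef (D : VermaData F) : ℕ → Idx → Idx → F → VInd F
  | 0 => coef0 D
  | 1 => coef1 D
  | 2 => coef2 D
  | 3 => coef3 D
  | _ => fun _ _ _ => 0

end

/-! ### A computable formal model of the vectors occurring in the formula -/

/-- Symbols for the vectors `v`, `t.v`, `C v`, `ξ_{j,i}.v` of `F`. -/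
inductive Sy : Type
  | vec : Sy
  | tee : Sy
  | cen : Sy
  | xi : Fin 4 → Fin 4 → Sy
  deriving DecidableEq

/-- Keys `Θ^k η_L ⊗ s`. -/
abbrev Key : Type := ℕ × Idx × Sy

/-- Formal integral combinations of keys. -/
abbrev FV : Type := List (ℤ × Key)

namespace FV

/-- A single formal term. -/
def sg (c : ℤ) (k : ℕ) (L : Idx) (s : Sy) : FV := [(c, (k, L, s))]

/-- A formal term `c Θ^k η_L ⊗ ξ_{j,i}.v`, normalized by antisymmetry. -/
def sx (c : ℤ) (k : ℕ) (L : Idx) (j i : Fin 4) : FV :=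
  if i < j then sg c k L (Sy.xi j i) else sg (-c) k L (Sy.xi i j)

/-- Scalar multiplication. -/
def sc (a : ℤ) (l : FV) : FV := l.map fun e => (a * e.1, e.2)

/-- Formal sum over `Fin 4`. -/
def su (f : Fin 4 → FV) : FV := f 0 ++ f 1 ++ f 2 ++ f 3

/-- Formal action of `η_i`. -/
def eta (i : Fin 4) (l : FV) : FV := l.map fun e =>
  if i ∈ e.2.2.1 then (e.1 * dsign i e.2.2.1, (e.2.1 + 1, e.2.2.1.erase i, e.2.2.2))
  else (e.1 * msign {i} e.2.2.1, (e.2.1, insert i e.2.2.1, e.2.2.2))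

/-- Coefficient of a key. -/
def co (l : FV) (k : Key) : ℤ := (l.map fun e => if e.2 = k then e.1 else 0).sum

/-- Test for being formally zero. -/
def isZ (l : FV) : Bool := l.all fun e => decide (co l e.2 = 0)

def c0 (I L : Idx) : FV :=
  (if I ⊆ L then sg ((-1 : ℤ) ^ I.card * ((I.card : ℤ) - 2) * ddsign I L) 1 (L \ I) Sy.vec else [])
  ++ su (fun i =>
      if i ∈ I ∧ i ∉ L ∧ I.erase i ⊆ insert i L then
        sg (dsign i I * msign {i} L * ddsign (I.erase i) (insert i L)) 0
          (insert i L \ I.erase i) Sy.vec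
      else [])
  ++ su (fun i => su fun j =>
      if i < j ∧ j ∈ I ∧ i ∈ I.erase j ∧ (I.erase j).erase i ⊆ L then
        sx ((-1 : ℤ) ^ I.card * dsign j I * dsign i (I.erase j) *
            ddsign ((I.erase j).erase i) L) 0 (L \ (I.erase j).erase i) j i
      else [])
  ++ (if I.card = 3 ∧ Iᶜ ⊆ L then
      sg (epsSign I * ddsign Iᶜ L) 0 (L \ Iᶜ) Sy.cen
     else [])

def c1 (I L : Idx) : FV :=
  (if I ⊆ L then sg ((-1 : ℤ) ^ I.card * ddsign I L) 0 (L \ I) Sy.tee else [])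
  ++ su (fun i =>
      if i ∈ L ∧ I ⊆ L.erase i then
        sg ((-1 : ℤ) ^ (I.card + L.card) * dsign i L * ddsign I (L.erase i) *
            msign ((L.erase i) \ I) {i}) 0 (insert i ((L.erase i) \ I)) Sy.vec
      else [])
  ++ su (fun i => su fun j =>
      if i ≠ j ∧ i ∈ I ∧ j ∈ L ∧ I.erase i ⊆ L.erase j then
        sx (dsign i I * dsign j L * ddsign (I.erase i) (L.erase j)) 0
          ((L.erase j) \ (I.erase i)) j i
      else [])
  ++ (if I.card = 2 ∧ Iᶜ ⊆ L then
      sg (epsSign I * ddsign Iᶜ L) 0 (L \ Iᶜ) Sy.cen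
     else [])

def c2 (I L : Idx) : FV :=
  su (fun i => su fun j =>
      if i < j ∧ j ∈ L ∧ i ∈ L.erase j ∧ I ⊆ (L.erase j).erase i then
        sx ((-1 : ℤ) ^ I.card * dsign j L * dsign i (L.erase j) *
            ddsign I ((L.erase j).erase i)) 0 (((L.erase j).erase i) \ I) j i
      else [])
  ++ sc (-1) (if I.card = 1 ∧ Iᶜ ⊆ L then
      sg (epsSign I * ddsign Iᶜ L) 0 (L \ Iᶜ) Sy.cen
     else [])

def c3 (I L : Idx) : FV :=
  sc (-1) (if I = ∅ ∧ Iᶜ ⊆ L then sg (ddsign Iᶜ L) 0 (L \ Iᶜ) Sy.cen else [])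

/-- Formal version of `m! • lamCoef`. -/
def lam : ℕ → Idx → Idx → FV
  | 0 => c0
  | 1 => c1
  | 2 => fun I L => sc 2 (c2 I L)
  | 3 => fun I L => sc 6 (c3 I L)
  | _ => fun _ _ => []

/-- Integral version of `psi0 I {i}`. -/
def ps (I : Idx) (i : Fin 4) : ℤ := if I = ({i}ᶜ : Idx) then -(dsign i Finset.univ) else 0

/-- Right-hand side of the recursion
`[t^m ξ_I, η_i] + (-1)^{|I|} η_i t^m ξ_I` applied to `η_L ⊗ v`. -/
def rhs (m : ℕ) (I : Idx) (i : Fin 4) (L : Idx) : FV :=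
  sc ((-1) ^ I.card) (eta i (lam m I L))
  ++ (if i ∈ I then sc ((-1) ^ I.card * dsign i I) (lam m (I.erase i) L)
      else sc (-(m : ℤ) * msign I {i}) (lam (m - 1) (I ∪ {i}) L))
  ++ sg (if m = 0 then ps I i else 0) 0 L Sy.cen

/-- The finite check. -/
def test (m : ℕ) (I : Idx) (i : Fin 4) (L : Idx) : Bool :=
  isZ (lam m I (insert i L) ++ sc (-1) (rhs m I i L))

/-! ### Bit-mask version of the formal model (for fast evaluation) -/

/-- Bit mask of an index set. -/
def msk (I : Idx) : ℕ := ∑ i ∈ I, 2 ^ (i : ℕ)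

/-- Code of a symbol. -/
def syc : Sy → ℕ
  | Sy.vec => 0
  | Sy.tee => 1
  | Sy.cen => 2
  | Sy.xi i j => 3 + (4 * (i : ℕ) + j)

abbrev NV : Type := List (ℤ × ℕ × ℕ × ℕ)

/-- Encoding of formal combinations. -/
def enc (l : FV) : NV := l.map fun e => (e.1, e.2.1, msk e.2.2.1, syc e.2.2.2)

def inN (i I : ℕ) : Bool := Nat.beq (I / 2 ^ i % 2) 1
def erN (I i : ℕ) : ℕ := Nat.land I (15 - 2 ^ i)
def isN (i I : ℕ) : ℕ := Nat.lor I (2 ^ i)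
def cpN (I : ℕ) : ℕ := 15 - I
def sdN (L S : ℕ) : ℕ := Nat.land L (15 - S)
def subN (I L : ℕ) : Bool := Nat.beq (Nat.land I L) I
def caN (I : ℕ) : ℕ := I % 2 + I / 2 % 2 + I / 4 % 2 + I / 8 % 2
def sgnN (n : ℕ) : ℤ := bif Nat.beq (n % 2) 0 then 1 else -1
def msE (I J : ℕ) : ℕ :=
  (I / 2 % 2) * caN (J % 2) + (I / 4 % 2) * caN (J % 4) + (I / 8 % 2) * caN (J % 8)
def msN (I J : ℕ) : ℤ := sgnN (msE I J)
def dsN (i I : ℕ) : ℤ := sgnN (caN (I % 2 ^ i))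
def ddN (S L : ℕ) : ℤ := sgnN (caN S * (caN S - 1) / 2 + msE S (sdN L S))
def epN (I : ℕ) : ℤ := msN I (cpN I)

def sgL (c : ℤ) (k L s : ℕ) : NV := [(c, k, L, s)]
def sxL (c : ℤ) (k L j i : ℕ) : NV :=
  bif Nat.blt i j then sgL c k L (3 + (4 * j + i)) else sgL (-c) k L (3 + (4 * i + j))
def scL (a : ℤ) (l : NV) : NV := l.map fun e => (a * e.1, e.2)
def suL (f : ℕ → NV) : NV := f 0 ++ f 1 ++ f 2 ++ f 3
def etaL (i : ℕ) (l : NV) : NV := l.map fun e =>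
  bif inN i e.2.2.1 then (e.1 * dsN i e.2.2.1, (e.2.1 + 1, erN e.2.2.1 i, e.2.2.2))
  else (e.1 * msN (2 ^ i) e.2.2.1, (e.2.1, isN i e.2.2.1, e.2.2.2))
def eqL (a b : ℕ × ℕ × ℕ) : Bool :=
  Nat.beq a.1 b.1 && (Nat.beq a.2.1 b.2.1 && Nat.beq a.2.2 b.2.2)
def coL (l : NV) (k : ℕ × ℕ × ℕ) : ℤ := (l.map fun e => bif eqL e.2 k then e.1 else 0).sum
def isZL (l : NV) : Bool := l.all fun e => decide (coL l e.2 = 0)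

def n0 (I L : ℕ) : NV :=
  (bif subN I L then sgL (sgnN (caN I) * ((caN I : ℤ) - 2) * ddN I L) 1 (sdN L I) 0 else [])
  ++ suL (fun i =>
      bif inN i I && (!inN i L && subN (erN I i) (isN i L)) then
        sgL (dsN i I * msN (2 ^ i) L * ddN (erN I i) (isN i L)) 0 (sdN (isN i L) (erN I i)) 0
      else [])
  ++ suL (fun i => suL fun j =>
      bif Nat.blt i j && (inN j I && (inN i (erN I j) && subN (erN (erN I j) i) L)) then
        sxL (sgnN (caN I) * dsN j I * dsN i (erN I j) * ddN (erN (erN I j) i) L) 0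
          (sdN L (erN (erN I j) i)) j i
      else [])
  ++ (bif Nat.beq (caN I) 3 && subN (cpN I) L then
      sgL (epN I * ddN (cpN I) L) 0 (sdN L (cpN I)) 2
     else [])

def n1 (I L : ℕ) : NV :=
  (bif subN I L then sgL (sgnN (caN I) * ddN I L) 0 (sdN L I) 1 else [])
  ++ suL (fun i =>
      bif inN i L && subN I (erN L i) then
        sgL (sgnN (caN I + caN L) * dsN i L * ddN I (erN L i) * msN (sdN (erN L i) I) (2 ^ i)) 0
          (isN i (sdN (erN L i) I)) 0
      else [])
  ++ suL (fun i => suL fun j =>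
      bif !Nat.beq i j && (inN i I && (inN j L && subN (erN I i) (erN L j))) then
        sxL (dsN i I * dsN j L * ddN (erN I i) (erN L j)) 0 (sdN (erN L j) (erN I i)) j i
      else [])
  ++ (bif Nat.beq (caN I) 2 && subN (cpN I) L then
      sgL (epN I * ddN (cpN I) L) 0 (sdN L (cpN I)) 2
     else [])

def n2 (I L : ℕ) : NV :=
  suL (fun i => suL fun j =>
      bif Nat.blt i j && (inN j L && (inN i (erN L j) && subN I (erN (erN L j) i))) then
        sxL (sgnN (caN I) * dsN j L * dsN i (erN L j) * ddN I (erN (erN L j) i)) 0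
          (sdN (erN (erN L j) i) I) j i
      else [])
  ++ scL (-1) (bif Nat.beq (caN I) 1 && subN (cpN I) L then
      sgL (epN I * ddN (cpN I) L) 0 (sdN L (cpN I)) 2
     else [])

def n3 (I L : ℕ) : NV :=
  scL (-1) (bif Nat.beq I 0 && subN (cpN I) L then
    sgL (ddN (cpN I) L) 0 (sdN L (cpN I)) 2 else [])

def lamL : ℕ → ℕ → ℕ → NV
  | 0 => n0
  | 1 => n1
  | 2 => fun I L => scL 2 (n2 I L)
  | 3 => fun I L => scL 6 (n3 I L)
  | _ => fun _ _ => []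

def psL (I i : ℕ) : ℤ := bif Nat.beq I (cpN (2 ^ i)) then -(dsN i 15) else 0

def rhsL (m I i L : ℕ) : NV :=
  scL (sgnN (caN I)) (etaL i (lamL m I L))
  ++ (bif inN i I then scL (sgnN (caN I) * dsN i I) (lamL m (erN I i) L)
      else scL (-(m : ℤ) * msN I (2 ^ i)) (lamL (m - 1) (isN i I) L))
  ++ sgL (bif Nat.beq m 0 then psL I i else 0) 0 L 2

def testL (m I i L : ℕ) : Bool := isZL (lamL m I (isN i L) ++ scL (-1) (rhsL m I i L))

def allL (m : ℕ) : Bool :=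
  (List.range 16).all fun I => (List.range 4).all fun i => (List.range 16).all fun L =>
    !Nat.beq (L % 2 ^ (i + 1)) 0 || testL m I i L

theorem all0 : allL 0 = true := by decide +kernel
theorem all1 : allL 1 = true := by decide +kernel
theorem all2 : allL 2 = true := by decide +kernel
theorem all3 : allL 3 = true := by decide +kernel

/-! Comparison with the formal model. -/

theorem inN_msk : ∀ (i : Fin 4) (I : Idx), inN i (msk I) = decide (i ∈ I) := by decide +kernel
theorem erN_msk : ∀ (i : Fin 4) (I : Idx), erN (msk I) i = msk (I.erase i) := by decide +kernel
theorem isN_msk : ∀ (i : Fin 4) (I : Idx), isN i (msk I) = msk (insert i I) := by decide +kernel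
theorem cpN_msk : ∀ I : Idx, cpN (msk I) = msk Iᶜ := by decide +kernel
theorem sdN_msk : ∀ I J : Idx, sdN (msk I) (msk J) = msk (I \ J) := by decide +kernel
theorem subN_msk : ∀ I J : Idx, subN (msk I) (msk J) = decide (I ⊆ J) := by decide +kernel
theorem caN_msk : ∀ I : Idx, caN (msk I) = I.card := by decide +kernel
theorem msN_msk : ∀ I J : Idx, msN (msk I) (msk J) = msign I J := by decide +kernel
theorem dsN_msk : ∀ (i : Fin 4) (I : Idx), dsN i (msk I) = dsign i I := by decide +kernel
theorem ddN_msk : ∀ I J : Idx, ddN (msk I) (msk J) = ddsign I J := by decide +kernel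
theorem epN_msk (I : Idx) : epN (msk I) = epsSign I := by
  rw [epN, cpN_msk, msN_msk, epsSign]
theorem two_pow_msk (i : Fin 4) : 2 ^ (i : ℕ) = msk {i} := by simp [msk]
theorem univ_msk : 15 = msk Finset.univ := by decide +kernel
theorem beq_zero_msk : ∀ I : Idx, Nat.beq (msk I) 0 = decide (I = ∅) := by decide +kernel
theorem beq_msk : ∀ I J : Idx, Nat.beq (msk I) (msk J) = decide (I = J) := by decide +kernel
theorem sgnN_eq (n : ℕ) : sgnN n = (-1) ^ n := by
  rcases Nat.even_or_odd n with h | h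
  · rw [h.neg_one_pow, sgnN, Nat.even_iff.mp h]; rfl
  · rw [h.neg_one_pow, sgnN, Nat.odd_iff.mp h]; rfl

theorem beq_dec (a b : ℕ) : Nat.beq a b = decide (a = b) := by
  rw [Bool.eq_iff_iff]; simp
theorem blt_fin (i j : Fin 4) : Nat.blt i j = decide (i < j) := by
  revert i j; decide
theorem beq_fin (i j : Fin 4) : Nat.beq i j = decide (i = j) := by
  revert i j; decide

theorem enc_append (l l' : FV) : enc (l ++ l') = enc l ++ enc l' := by simp [enc]
theorem enc_nil : enc [] = [] := rfl
theorem enc_sg (c : ℤ) (k : ℕ) (L : Idx) (s : Sy) :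
    enc (sg c k L s) = sgL c k (msk L) (syc s) := rfl
theorem enc_sc (a : ℤ) (l : FV) : enc (sc a l) = scL a (enc l) := by
  simp [enc, sc, scL]
theorem enc_su (f : Fin 4 → FV) (g : ℕ → NV) (h : ∀ i : Fin 4, g i = enc (f i)) :
    suL g = enc (su f) := by
  have h0 := h 0
  have h1 := h 1
  have h2 := h 2
  have h3 := h 3
  simp only [su, suL, enc_append, ← h0, ← h1, ← h2, ← h3]
  rfl
theorem enc_ite (P : Prop) [Decidable P] (l l' : FV) :
    enc (if P then l else l') = bif decide P then enc l else enc l' := by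
  by_cases h : P <;> simp [h]
theorem enc_sx (c : ℤ) (k : ℕ) (L : Idx) (j i : Fin 4) :
    enc (sx c k L j i) = sxL c k (msk L) j i := by
  rw [sx, enc_ite, enc_sg, enc_sg, sxL, blt_fin]; rfl
theorem enc_eta (i : Fin 4) (l : FV) : enc (eta i l) = etaL i (enc l) := by
  simp only [enc, eta, etaL, List.map_map]
  apply List.map_congr_left
  intro e _
  simp only [Function.comp, inN_msk, dsN_msk, two_pow_msk, msN_msk, erN_msk, isN_msk]
  by_cases h : i ∈ e.2.2.1 <;> simp [h]

theorem enc_c0 (I L : Idx) : n0 (msk I) (msk L) = enc (c0 I L) := by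
  unfold n0 c0
  rw [enc_append, enc_append, enc_append]
  congr 1
  · congr 1
    · congr 1
      · simp only [enc_ite, enc_sg, enc_nil, subN_msk, caN_msk, ddN_msk, sdN_msk, sgnN_eq, syc]
      · apply enc_su
        intro i
        simp only [enc_ite, enc_sg, enc_nil, subN_msk, inN_msk, erN_msk, isN_msk, dsN_msk,
          two_pow_msk, msN_msk, ddN_msk, sdN_msk, syc, Bool.decide_and, decide_not]
    · apply enc_su
      intro i
      apply enc_su
      intro j
      simp only [enc_ite, enc_sx, enc_nil, subN_msk, inN_msk, erN_msk, dsN_msk,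
        ddN_msk, sdN_msk, Bool.decide_and, blt_fin, caN_msk, sgnN_eq]
  · simp only [enc_ite, enc_sg, enc_nil, subN_msk, caN_msk, ddN_msk, sdN_msk, syc, cpN_msk,
      epN_msk, Bool.decide_and, beq_dec]

theorem enc_c1 (I L : Idx) : n1 (msk I) (msk L) = enc (c1 I L) := by
  unfold n1 c1
  rw [enc_append, enc_append, enc_append]
  congr 1
  · congr 1
    · congr 1
      · simp only [enc_ite, enc_sg, enc_nil, subN_msk, caN_msk, ddN_msk, sdN_msk, sgnN_eq, syc]
      · apply enc_su
        intro i
        simp only [enc_ite, enc_sg, enc_nil, subN_msk, inN_msk, erN_msk, isN_msk, dsN_msk,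
          two_pow_msk, msN_msk, ddN_msk, sdN_msk, syc, Bool.decide_and, caN_msk, sgnN_eq]
    · apply enc_su
      intro i
      apply enc_su
      intro j
      simp only [enc_ite, enc_sx, enc_nil, subN_msk, inN_msk, erN_msk, dsN_msk,
        ddN_msk, sdN_msk, Bool.decide_and, beq_fin, ne_eq, decide_not]
  · simp only [enc_ite, enc_sg, enc_nil, subN_msk, caN_msk, ddN_msk, sdN_msk, syc, cpN_msk,
      epN_msk, Bool.decide_and, beq_dec]

theorem enc_c2 (I L : Idx) : n2 (msk I) (msk L) = enc (c2 I L) := by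
  unfold n2 c2
  rw [enc_append]
  congr 1
  · apply enc_su
    intro i
    apply enc_su
    intro j
    simp only [enc_ite, enc_sx, enc_nil, subN_msk, inN_msk, erN_msk, dsN_msk,
      ddN_msk, sdN_msk, Bool.decide_and, blt_fin, caN_msk, sgnN_eq]
  · simp only [enc_ite, enc_sg, enc_nil, subN_msk, caN_msk, ddN_msk, sdN_msk, syc, cpN_msk,
      epN_msk, Bool.decide_and, beq_dec, enc_sc]

theorem enc_c3 (I L : Idx) : n3 (msk I) (msk L) = enc (c3 I L) := by
  simp only [n3, c3, enc_ite, enc_sg, enc_nil, subN_msk, ddN_msk, sdN_msk, syc, cpN_msk,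
    Bool.decide_and, beq_zero_msk, enc_sc]

theorem enc_lam (m : ℕ) (I L : Idx) : lamL m (msk I) (msk L) = enc (lam m I L) := by
  match m with
  | 0 => exact enc_c0 I L
  | 1 => exact enc_c1 I L
  | 2 => simp only [lamL, lam, enc_sc, enc_c2]
  | 3 => simp only [lamL, lam, enc_sc, enc_c3]
  | _ + 4 => rfl

theorem psL_msk (I : Idx) (i : Fin 4) : psL (msk I) i = ps I i := by
  rw [psL, univ_msk, dsN_msk, two_pow_msk, cpN_msk, beq_msk, ps]
  by_cases h : I = {i}ᶜ <;> simp [h]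

theorem enc_rhs (m : ℕ) (I : Idx) (i : Fin 4) (L : Idx) :
    rhsL m (msk I) i (msk L) = enc (rhs m I i L) := by
  have hu : I ∪ {i} = insert i I := by rw [Finset.union_comm]; rfl
  have hm : (bif Nat.beq m 0 then ps I i else 0) = if m = 0 then ps I i else 0 := by
    rw [beq_dec]; by_cases h : m = 0 <;> simp [h]
  rw [rhsL, rhs, psL_msk, hm, hu]
  simp only [enc_append, enc_sc, enc_eta, enc_ite, enc_sg, syc, inN_msk, caN_msk, sgnN_eq,
    dsN_msk, two_pow_msk, msN_msk, erN_msk, isN_msk, enc_lam]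

theorem msk_inj (I J : Idx) (h : msk I = msk J) : I = J := by
  have := beq_msk I J
  rw [beq_dec, decide_eq_true h] at this
  exact of_decide_eq_true this.symm

theorem syc_inj (s s' : Sy) (h : syc s = syc s') : s = s' := by
  cases s <;> cases s' <;> simp only [syc] at h <;> first | rfl | omega | skip
  simp only [Sy.xi.injEq, Fin.ext_iff]
  omega

theorem eqL_enc (a b : Key) :
    eqL (a.1, msk a.2.1, syc a.2.2) (b.1, msk b.2.1, syc b.2.2) = decide (a = b) := by
  obtain ⟨k, L, s⟩ := a
  obtain ⟨k', L', s'⟩ := b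
  rw [Bool.eq_iff_iff]
  simp only [eqL, Bool.and_eq_true, Nat.beq_eq, decide_eq_true_eq, Prod.mk.injEq]
  constructor
  · rintro ⟨h1, h2, h3⟩; exact ⟨h1, msk_inj _ _ h2, syc_inj _ _ h3⟩
  · rintro ⟨rfl, rfl, rfl⟩; exact ⟨rfl, rfl, rfl⟩

theorem coL_enc (l : FV) (k : Key) :
    coL (enc l) (k.1, msk k.2.1, syc k.2.2) = co l k := by
  simp only [coL, enc, co, List.map_map]
  congr 1
  apply List.map_congr_left
  intro e _
  simp only [Function.comp, eqL_enc]
  by_cases h : e.2 = k <;> simp [h]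

theorem isZ_of_enc (l : FV) (h : isZL (enc l) = true) : isZ l = true := by
  rw [isZ, List.all_eq_true]
  intro e he
  have := List.all_eq_true.mp h _ (List.mem_map_of_mem he)
  simpa [coL_enc] using this

theorem msk_lt : ∀ I : Idx, msk I < 16 := by decide +kernel

theorem msk_min : ∀ (i : Fin 4) (L : Idx), (∀ x ∈ L, i < x) →
    Nat.beq (msk L % 2 ^ ((i : ℕ) + 1)) 0 = true := by decide +kernel

theorem test_of_all (m : ℕ) (h : allL m = true) (I : Idx) (i : Fin 4) (L : Idx)
    (hL : ∀ x ∈ L, i < x) : test m I i L = true := by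
  have h1 := List.all_eq_true.mp h (msk I) (List.mem_range.mpr (msk_lt I))
  have h2 := List.all_eq_true.mp h1 i (List.mem_range.mpr i.isLt)
  have h3 := List.all_eq_true.mp h2 (msk L) (List.mem_range.mpr (msk_lt L))
  rw [msk_min i L hL, Bool.not_true, Bool.false_or, testL, isN_msk, enc_lam, enc_rhs,
    ← enc_sc, ← enc_append] at h3
  exact isZ_of_enc _ h3

variable {F : Type*} [AddCommGroup F] [Module ℂ F]

/-- Interpretation of the symbols. -/
noncomputable def sop (D : VermaData F) : Sy → F → F
  | Sy.vec => fun v => v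
  | Sy.tee => fun v => D.ρt v
  | Sy.cen => fun v => D.ρC v
  | Sy.xi i j => fun v => D.ρξ i j v

/-- Interpretation of a key. -/
noncomputable def evk (D : VermaData F) (v : F) (k : Key) : VInd F :=
  bv k.1 k.2.1 (sop D k.2.2 v)

/-- Interpretation of a formal combination. -/
noncomputable def ev (D : VermaData F) (v : F) (l : FV) : VInd F :=
  (l.map fun e => (e.1 : ℂ) • evk D v e.2).sum

theorem ev_nil (D : VermaData F) (v : F) : ev D v [] = 0 := rfl

theorem ev_cons (D : VermaData F) (v : F) (e : ℤ × Key) (l : FV) :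
    ev D v (e :: l) = (e.1 : ℂ) • evk D v e.2 + ev D v l := by simp [ev]

theorem ev_append (D : VermaData F) (v : F) (l l' : FV) :
    ev D v (l ++ l') = ev D v l + ev D v l' := by simp [ev]

theorem ev_sg (D : VermaData F) (v : F) (c : ℤ) (k : ℕ) (L : Idx) (s : Sy) :
    ev D v (sg c k L s) = (c : ℂ) • bv k L (sop D s v) := by simp [ev, sg, evk]

theorem bv_neg (k : ℕ) (L : Idx) (v : F) : bv k L (-v) = - bv k L v := by
  simp [bv]

theorem ev_sx (D : VermaData F) (hD : IsVerma D) (v : F) (c : ℤ) (k : ℕ) (L : Idx) (j i : Fin 4) :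
    ev D v (sx c k L j i) = (c : ℂ) • bv k L (D.ρξ j i v) := by
  unfold sx
  split_ifs
  · rw [ev_sg]; rfl
  · rw [ev_sg, hD.anti j i]
    simp [sop, bv_neg]

theorem ev_sc (D : VermaData F) (v : F) (a : ℤ) (l : FV) :
    ev D v (sc a l) = (a : ℂ) • ev D v l := by
  induction l with
  | nil => simp [sc, ev]
  | cons e l ih =>
    have : sc a (e :: l) = (a * e.1, e.2) :: sc a l := rfl
    rw [this, ev_cons, ev_cons, ih, smul_add, smul_smul]
    push_cast; rfl

theorem ev_su (D : VermaData F) (v : F) (f : Fin 4 → FV) :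
    ev D v (su f) = ∑ i, ev D v (f i) := by
  simp only [su, ev_append, Fin.sum_univ_four]

theorem ev_ite (D : VermaData F) (v : F) (P : Prop) [Decidable P] (l l' : FV) :
    ev D v (if P then l else l') = if P then ev D v l else ev D v l' := by
  split_ifs <;> rfl

theorem ev_eta (D : VermaData F) (hD : IsVerma D) (v : F) (i : Fin 4) (l : FV) :
    ev D v (eta i l) = D.act 0 {i} (ev D v l) := by
  induction l with
  | nil => simp [eta, ev]
  | cons e l ih =>
    have h : ∀ e' : ℤ × Key, eta i (e' :: l) = (if i ∈ e'.2.2.1 then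
        (e'.1 * dsign i e'.2.2.1, (e'.2.1 + 1, e'.2.2.1.erase i, e'.2.2.2))
      else (e'.1 * msign {i} e'.2.2.1, (e'.2.1, insert i e'.2.2.1, e'.2.2.2))) :: eta i l :=
      fun _ => rfl
    rw [h, ev_cons, ev_cons, ih, map_add, map_smul]
    congr 1
    rw [show evk D v e.2 = bv e.2.1 e.2.2.1 (sop D e.2.2.2 v) from rfl, hD.low_eta]
    split_ifs <;> simp [evk, smul_smul]

theorem ev_eq_zero (D : VermaData F) (v : F) (l : FV) (h : isZ l = true) : ev D v l = 0 := by
  classical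
  let T : FV → (Key →₀ ℂ) := fun l => (l.map fun e => Finsupp.single e.2 (e.1 : ℂ)).sum
  have hT : ∀ l : FV, ev D v l = Finsupp.linearCombination ℂ (evk D v) (T l) := by
    intro l
    induction l with
    | nil => simp [T, ev]
    | cons e l ih => rw [ev_cons, ih]; simp [T, Finsupp.linearCombination_single]
  have hc : ∀ (l : FV) (k : Key), T l k = (co l k : ℂ) := by
    intro l k
    induction l with
    | nil => simp [T, co]
    | cons e l ih =>
      have h1 : T (e :: l) = Finsupp.single e.2 (e.1 : ℂ) + T l := by simp [T]
      have h2 : co (e :: l) k = (if e.2 = k then e.1 else 0) + co l k := by simp [co]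
      rw [h1, h2, Finsupp.add_apply, ih, Finsupp.single_apply]
      push_cast
      rfl
  have h0 : T l = 0 := by
    ext k
    rw [hc, Finsupp.zero_apply]
    by_cases hk : ∃ e ∈ l, e.2 = k
    · obtain ⟨e, he, rfl⟩ := hk
      have := (List.all_eq_true.mp h) e he
      exact_mod_cast of_decide_eq_true this
    · have : co l k = 0 := by
        unfold co
        apply List.sum_eq_zero
        intro x hx
        obtain ⟨e, he, rfl⟩ := List.mem_map.mp hx
        rw [if_neg (fun h' => hk ⟨e, he, h'⟩)]
      exact_mod_cast this
  rw [hT, h0, map_zero]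

theorem ev_eq (D : VermaData F) (v : F) (l l' : FV) (h : isZ (l ++ sc (-1) l') = true) :
    ev D v l = ev D v l' := by
  have := ev_eq_zero D v _ h
  rw [ev_append, ev_sc] at this
  simpa [add_neg_eq_zero] using this

theorem ev_lam (D : VermaData F) (hD : IsVerma D) (m : ℕ) (I L : Idx) (v : F) :
    ev D v (lam m I L) = (m.factorial : ℂ) • lamCoef D m I L v := by
  match m with
  | 0 =>
    simp only [lam, lamCoef, c0, coef0, ev_append, ev_su, ev_ite, ev_sg, ev_sx D hD, ev_nil, sop,
      Nat.factorial, Nat.cast_one, one_smul]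
  | 1 =>
    simp only [lam, lamCoef, c1, coef1, ev_append, ev_su, ev_ite, ev_sg, ev_sx D hD, ev_nil, sop,
      Nat.factorial, Nat.cast_one, one_smul, mul_one]
  | 2 =>
    simp only [lam, lamCoef, c2, coef2, ev_append, ev_su, ev_ite, ev_sg, ev_sx D hD, ev_nil, sop,
      ev_sc]
    norm_num [Nat.factorial, sub_eq_add_neg]
    split_ifs <;> simp
  | 3 =>
    simp only [lam, lamCoef, c3, coef3, ev_ite, ev_sg, ev_nil, sop, ev_sc]
    norm_num [Nat.factorial]
    split_ifs <;> simp
  | m + 4 => simp [lam, lamCoef, ev_nil]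

theorem psi0_single (I : Idx) (i : Fin 4) : psi0 I {i} = (ps I i : ℂ) := by
  have h1 : ({i} : Idx) ≠ Finset.univ := by revert i; decide
  have h2 : ({i} : Idx) ≠ ∅ := Finset.singleton_ne_empty i
  have h3 : ∀ j : Fin 4, ({i} : Idx) ≠ {j}ᶜ := by revert i; decide
  have h4 : ∀ j : Fin 4, (I = ({j}ᶜ : Idx) ∧ ({i} : Idx) = {j}) ↔ (j = i ∧ I = ({i}ᶜ : Idx)) := by
    intro j
    rw [Finset.singleton_inj]
    constructor
    · rintro ⟨rfl, rfl⟩; exact ⟨rfl, rfl⟩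
    · rintro ⟨rfl, rfl⟩; exact ⟨rfl, rfl⟩
  unfold psi0 ps
  simp only [h1, h2, h3, h4, and_false, if_false, Finset.sum_const_zero, zero_add, ite_and,
    Finset.sum_ite_eq', Finset.mem_univ, if_true]
  split_ifs <;> push_cast <;> rfl

theorem Cop_bv (ρ : F →ₗ[ℂ] F) (k : ℕ) (L : Idx) (v : F) : Cop ρ (bv k L v) = bv k L (ρ v) := by
  simp [Cop, bv]

theorem brk_single (D : VermaData F) (m : ℕ) (I : Idx) (i : Fin 4) (L : Idx) (v : F) :
    brkAct D.ρC D.act m I 0 {i} (bv 0 L v) =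
      (if i ∈ I then (((-1) ^ I.card * dsign i I : ℤ) : ℂ) • D.act m (I.erase i) (bv 0 L v)
        else ((-(m : ℤ) * msign I {i} : ℤ) : ℂ) • D.act (m - 1) (I ∪ {i}) (bv 0 L v))
      + ((if m = 0 then ps I i else 0 : ℤ) : ℂ) • bv 0 L (D.ρC v) := by
  have hs : (∑ j : Fin 4,
      if j ∈ I ∧ j ∈ ({i} : Idx) ∧ Disjoint (I.erase j) (({i} : Idx).erase j) then
        ((dsign j I * dsign j {i} * msign (I.erase j) (({i} : Idx).erase j) : ℤ) : ℂ) •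
          D.act (m + 0) (I.erase j ∪ ({i} : Idx).erase j)
      else 0) = if i ∈ I then ((dsign i I : ℤ) : ℂ) • D.act m (I.erase i) else 0 := by
    rw [Finset.sum_eq_single i]
    · have : dsign i {i} = 1 := by revert i; decide
      simp [this, msign]
    · intro j _ hj
      simp [hj]
    · simp
  unfold brkAct
  rw [hs, psi0_single]
  simp only [LinearMap.add_apply, LinearMap.smul_apply, Cop_bv]
  by_cases hi : i ∈ I
  · by_cases hm : m = 0 <;> simp [hi, hm, smul_smul]
  · by_cases hm : m = 0
    · simp [hi, hm]
    · simp [hi, hm, smul_smul]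
      rw [← neg_smul]; congr 1; ring

theorem ev_rec (D : VermaData F) (v : F) (m : ℕ) (I : Idx) (i : Fin 4) (L : Idx)
    (h : ∀ x ∈ L, i < x) : ev D v (lam m I (insert i L)) = ev D v (rhs m I i L) := by
  match m with
  | 0 => exact ev_eq D v _ _ (test_of_all 0 all0 I i L h)
  | 1 => exact ev_eq D v _ _ (test_of_all 1 all1 I i L h)
  | 2 => exact ev_eq D v _ _ (test_of_all 2 all2 I i L h)
  | 3 => exact ev_eq D v _ _ (test_of_all 3 all3 I i L h)
  | 4 => simp [lam, rhs, eta, sc, c3, ev_sg, ev_nil]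
  | m + 5 => simp [lam, rhs, eta, sc, ev_sg, ev_nil]

theorem base_pos : ∀ m : Fin 4, ∀ I : Idx, 2 < 2 * (m : ℕ) + I.card →
    isZ (lam m I ∅) = true := by decide +kernel

theorem base_eta : ∀ i : Fin 4, isZ (lam 0 {i} ∅ ++ sc (-1) (sg 1 0 {i} Sy.vec)) = true := by
  decide +kernel

theorem base_xi : ∀ i j : Fin 4, i < j →
    isZ (lam 0 {i, j} ∅ ++ sc (-1) (sx 1 0 ∅ i j)) = true := by
  decide +kernel

theorem base_one : isZ (lam 0 ∅ ∅ ++ sc (-1) (sg (-2) 1 ∅ Sy.vec)) = true := by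
  decide +kernel

theorem base_t : isZ (lam 1 ∅ ∅ ++ sc (-1) (sg 1 0 ∅ Sy.tee)) = true := by
  decide +kernel

theorem small_cases : ∀ I : Idx, I.card ≤ 2 →
    I = ∅ ∨ (∃ i, I = {i}) ∨ ∃ i j, i < j ∧ I = {i, j} := by decide +kernel

theorem base (D : VermaData F) (hD : IsVerma D) (v : F) (m : ℕ) (I : Idx) :
    D.act m I (bv 0 ∅ v) = ev D v (lam m I ∅) := by
  by_cases hp : 2 < 2 * m + I.card
  · rw [hD.vac_pos v m I hp]
    by_cases hm : m < 4
    · exact (ev_eq_zero D v _ (base_pos ⟨m, hm⟩ I hp)).symm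
    · obtain ⟨k, rfl⟩ : ∃ k, m = k + 4 := ⟨m - 4, by omega⟩
      simp [lam, ev_nil]
  · have hm : m = 0 ∨ m = 1 := by omega
    rcases hm with rfl | rfl
    · rcases small_cases I (by omega) with rfl | ⟨i, rfl⟩ | ⟨i, j, hij, rfl⟩
      · rw [hD.low_one, ev_eq D v _ _ base_one, ev_sg]
        simp [sop]
      · rw [hD.low_eta, ev_eq D v _ _ (base_eta i), ev_sg]
        simp [sop, msign]
      · rw [hD.vac_xi v i j hij, ev_eq D v _ _ (base_xi i j hij), ev_sx D hD]
        simp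
    · have : I = ∅ := Finset.card_eq_zero.mp (by omega)
      subst this
      rw [hD.vac_t, ev_eq D v _ _ base_t, ev_sg]
      simp [sop]

theorem msign_min : ∀ (i : Fin 4) (L : Idx), (∀ x ∈ L, i < x) → msign {i} L = 1 := by
  decide +kernel

theorem main (D : VermaData F) (hD : IsVerma D) (v : F) (L : Idx) :
    ∀ (m : ℕ) (I : Idx), D.act m I (bv 0 L v) = ev D v (lam m I L) := by
  induction L using Finset.induction_on_min with
  | empty => exact base D hD v
  | insert i L hL ih =>
    intro m I
    have hi : i ∉ L := fun h => lt_irrefl _ (hL i h)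
    have h1 : bv 0 (insert i L) v = D.act 0 {i} (bv 0 L v) := by
      rw [hD.low_eta, if_neg hi, msign_min i L hL]; simp
    have h2 := congrArg (fun f => f (bv 0 L v)) (hD.lie m I 0 {i})
    simp only [LinearMap.sub_apply, LinearMap.smul_apply, LinearMap.comp_apply,
      Finset.card_singleton, mul_one] at h2
    rw [ev_rec D v m I i L hL, h1, sub_eq_iff_eq_add.mp h2, brk_single, ih, ih, ih]
    simp only [rhs, ev_append, ev_ite, ev_sc, ev_eta D hD, ev_sg, sop]
    push_cast
    abel

end FV

/-- **Explicit `λ`-action on Verma modules** (Proposition `action`).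
For `I, L` (strictly increasing sequences of distinct indices, encoded as finsets) and
`v ∈ F`, the `λ`-action `ξ_I ∙_λ (η_L ⊗ v) = ∑_{m≥0} (λ^m/m!) (t^m ξ_I).(η_L ⊗ v)` is given by

`ξ_I ∙_λ (η_L ⊗ v) = (-1)^{|I|}(|I|-2) Θ ∂_I η_L ⊗ v + ∑ᵢ ∂_{∂ᵢξ_I}(ξᵢ ⋆ η_L) ⊗ v`
`  + (-1)^{|I|} ∑_{i<j} ∂_{∂ᵢ∂ⱼξ_I} η_L ⊗ ξ_{j,i}.v + χ_{|I|=3} ε_I ∂_{Iᶜ} η_L ⊗ Cv`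
`  + λ [ (-1)^{|I|} ∂_I η_L ⊗ t.v + (-1)^{|I|+|L|} ∑ᵢ (∂_{Ii} η_L ⋆ ξᵢ) ⊗ v`
`        + ∑_{i≠j} ∂_{∂ᵢξ_I}(∂ⱼ η_L) ⊗ ξ_{j,i}.v + χ_{|I|=2} ε_I ∂_{Iᶜ} η_L ⊗ Cv ]`
`  + λ² [ (-1)^{|I|} ∑_{i<j} ∂_{Iij} η_L ⊗ ξ_{j,i}.v - χ_{|I|=1} ε_I ∂_{Iᶜ} η_L ⊗ Cv ]`
`  + λ³ [ -χ_{|I|=0} ∂_{Iᶜ} η_L ⊗ Cv ]`,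

stated coefficientwise: `(t^m ξ_I).(η_L ⊗ v) = m! • (coefficient of λ^m above)`. -/
theorem lambda_action_formula
    (F : Type*) [AddCommGroup F] [Module ℂ F] [FiniteDimensional ℂ F]
    (D : VermaData F) (hD : IsVerma D) (hirr : IsIrred D) :
    ∀ (I L : Idx) (v : F) (m : ℕ),
      D.act m I (bv 0 L v) = (m.factorial : ℂ) • lamCoef D m I L v := by
  intro I L v m
  rw [FV.main D hD v L m I, FV.ev_lam D hD]
end

section
/- If m⃗ ∈ Ind(F) is a singular vector over g = A(K'_4), and T(m⃗) = Σ_{k=0}^N Σ_L Θ^k η_L ⊗ v_{L,k} with v_{L,k} ∈ F, then v_{L,k} = 0 for all k ≥ 4; that is, the degree of T(m⃗) in Θ is at most 3. -/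
/-!
Core definitions modelling the annihilation superalgebra `𝔤 = 𝒜(K'₄) = K(1,4)₊ ⊕ ℂC`
and generalized Verma modules `Ind F ≅ ℂ[Θ] ⊗ Λ(η₁,…,η₄) ⊗ F` over it.

Grassmann monomials `ξ_I`/`η_I` (with `I` in increasing order) are indexed by
`Idx = Finset (Fin 4)`.
-/

open Finset

section helpers
variable {F : Type*} [AddCommGroup F] [Module ℂ F]

/-- Extensionality on the vectors `Θ^k η_L ⊗ v`. -/
lemma bv_ext {M : Type*} [AddCommGroup M] [Module ℂ M] {f g : VInd F →ₗ[ℂ] M}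
    (h : ∀ k L v, f (bv k L v) = g (bv k L v)) : f = g :=
  Finsupp.lhom_ext (fun p v => h p.1 p.2 v)

/-- Vectors of degree `d` (as a submodule). -/
def gr (F : Type*) [AddCommGroup F] [Module ℂ F] (d : ℤ) : Submodule ℂ (VInd F) :=
  Finsupp.supported F ℂ {p : ℕ × Idx | 2 * (p.1 : ℤ) + (p.2.card : ℤ) = d}

/-- Vectors of `Θ`-degree at most `n`. -/
def thLe (F : Type*) [AddCommGroup F] [Module ℂ F] (n : ℕ) : Submodule ℂ (VInd F) :=
  Finsupp.supported F ℂ {p : ℕ × Idx | p.1 ≤ n}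

lemma bv_mem_gr (k : ℕ) (L : Idx) (v : F) (d : ℤ) (h : 2 * (k : ℤ) + (L.card : ℤ) = d) :
    bv k L v ∈ gr F d :=
  Finsupp.single_mem_supported ℂ v h

lemma bv_mem_thLe (k : ℕ) (L : Idx) (v : F) (n : ℕ) (h : k ≤ n) : bv k L v ∈ thLe F n :=
  Finsupp.single_mem_supported ℂ v h

/-- A linear map sending basis vectors of a supported submodule to `q` sends it into `q`. -/
lemma supported_induction {M : Type*} [AddCommGroup M] [Module ℂ M] (s : Set (ℕ × Idx))
    (f : VInd F →ₗ[ℂ] M) (q : Submodule ℂ M)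
    (h : ∀ k L v, (k, L) ∈ s → f (bv k L v) ∈ q) (x : VInd F)
    (hx : x ∈ Finsupp.supported F ℂ s) : f x ∈ q := by
  rw [← Finsupp.sum_single x, Finsupp.sum, map_sum]
  refine Submodule.sum_mem _ fun p hp => h p.1 p.2 (x p) ?_
  exact (Finsupp.mem_supported ℂ x).1 hx hp

lemma gr_le_thLe (d : ℤ) (n : ℕ) (h : d < 2 * (n : ℤ) + 2) : gr F d ≤ thLe F n := by
  apply Finsupp.supported_mono
  intro p hp
  simp only [Set.mem_ofPred_eq] at hp ⊢
  omega

lemma gr_neg (d : ℤ) (h : d < 0) (x : VInd F) (hx : x ∈ gr F d) : x = 0 := by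
  have := supported_induction _ LinearMap.id (⊥ : Submodule ℂ (VInd F)) (fun k L v hk => by
    simp only [Set.mem_ofPred_eq] at hk
    omega) x hx
  simpa using this

/-- Derivation with respect to `Θ`. -/
noncomputable def dOp : VInd F →ₗ[ℂ] VInd F :=
  Finsupp.lsum ℂ (fun p => (p.1 : ℂ) • Finsupp.lsingle (p.1 - 1, p.2))

lemma dOp_bv (k : ℕ) (L : Idx) (v : F) : dOp (bv k L v) = (k : ℂ) • bv (k - 1) L v := by
  simp [dOp, bv]

lemma thOp_bv (k : ℕ) (L : Idx) (v : F) : thOp (bv k L v) = bv (k + 1) L v := by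
  simp [thOp, bv, Finsupp.mapDomain_single]

lemma dOp_thOp (x : VInd F) : dOp (thOp x) = thOp (dOp x) + x := by
  have : (dOp ∘ₗ thOp : VInd F →ₗ[ℂ] VInd F) = thOp ∘ₗ dOp + LinearMap.id := by
    apply bv_ext
    intro k L v
    simp only [LinearMap.comp_apply, LinearMap.add_apply, LinearMap.id_apply, thOp_bv, dOp_bv,
      map_smul]
    cases k with
    | zero => simp
    | succ k => simp [add_smul]
  exact LinearMap.congr_fun this x

lemma dOp_thLe_succ (n : ℕ) (x : VInd F) (hx : x ∈ thLe F (n + 1)) : dOp x ∈ thLe F n := by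
  refine supported_induction _ dOp _ (fun k L v hk => ?_) x hx
  rw [dOp_bv]
  simp only [Set.mem_ofPred_eq] at hk
  exact Submodule.smul_mem _ _ (bv_mem_thLe _ _ _ _ (by omega))

lemma dOp_thLe_zero (x : VInd F) (hx : x ∈ thLe F 0) : dOp x = 0 := by
  have := supported_induction _ dOp (⊥ : Submodule ℂ (VInd F)) (fun k L v hk => by
    simp only [Set.mem_ofPred_eq, Nat.le_zero] at hk
    subst hk
    simp [dOp_bv]) x hx
  simpa using this

lemma dOp_apply (x : VInd F) (k : ℕ) (L : Idx) :
    dOp x (k, L) = ((k : ℂ) + 1) • x (k + 1, L) := by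
  have : (Finsupp.lapply (k, L) ∘ₗ dOp : VInd F →ₗ[ℂ] F)
      = ((k : ℂ) + 1) • Finsupp.lapply (k + 1, L) := by
    apply bv_ext
    intro k' L' v
    simp only [LinearMap.comp_apply, dOp_bv, map_smul, LinearMap.smul_apply, Finsupp.lapply_apply]
    cases k' with
    | zero => simp [bv, Finsupp.single_apply]
    | succ n =>
      simp only [bv, Finsupp.single_apply, Prod.mk.injEq, Nat.add_sub_cancel, add_left_inj]
      by_cases h : n = k ∧ L' = L
      · obtain ⟨rfl, rfl⟩ := h
        simp
      · simp [h]
  exact LinearMap.congr_fun this x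

lemma thOp_apply (x : VInd F) (k : ℕ) (L : Idx) : thOp x (k + 1, L) = x (k, L) := by
  have : (Finsupp.lapply (k + 1, L) ∘ₗ thOp : VInd F →ₗ[ℂ] F) = Finsupp.lapply (k, L) := by
    apply bv_ext
    intro k' L' v
    simp only [LinearMap.comp_apply, thOp_bv, Finsupp.lapply_apply]
    simp [bv, Finsupp.single_apply]
  exact LinearMap.congr_fun this x

lemma psi0_card (I : Idx) (i : Fin 4) (h : psi0 I {i} ≠ 0) : I.card = 3 := by
  by_contra hI
  apply h
  have h1 : ({i} : Idx) ≠ Finset.univ := by clear * -; revert i; decide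
  have h3 : ∀ j : Fin 4, ({i} : Idx) ≠ {j}ᶜ := by clear * -; revert i; decide
  have h4 : ∀ j : Fin 4, I ≠ {j}ᶜ := by
    rintro j rfl
    apply hI
    clear * -
    revert j; decide
  simp [psi0, h1, h3, h4]

lemma psi0_single_empty (i : Fin 4) : psi0 {i} ∅ = 0 := by
  have h1 : ({i} : Idx) ≠ Finset.univ := by revert i; decide
  have h3 : ∀ j : Fin 4, (∅ : Idx) ≠ {j}ᶜ := by decide
  simp [psi0, h1, h3]

variable {D : VermaData F}

lemma act_eta_gr (hD : IsVerma D) (i : Fin 4) (d : ℤ) (x : VInd F) (hx : x ∈ gr F d) :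
    D.act 0 {i} x ∈ gr F (d + 1) := by
  refine supported_induction _ _ _ (fun k L v hk => ?_) x hx
  simp only [Set.mem_ofPred_eq] at hk
  rw [hD.low_eta]
  split_ifs with h
  · refine Submodule.smul_mem _ _ (bv_mem_gr _ _ _ _ ?_)
    have := Finset.card_erase_add_one h
    push_cast
    omega
  · refine Submodule.smul_mem _ _ (bv_mem_gr _ _ _ _ ?_)
    have := Finset.card_insert_of_notMem h
    omega

lemma msign_min (a : Fin 4) (L : Idx) : ((msign {a} L : ℤ) : ℂ) * ((msign {a} L : ℤ) : ℂ) = 1 := by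
  rw [← Int.cast_mul]
  have : msign {a} L * msign {a} L = 1 := by
    unfold msign
    rw [← mul_pow]
    simp
  rw [this]; simp

/-- The action respects the grading on `Λ(η) ⊗ F`. -/
lemma act_gr (hD : IsVerma D) (L : Idx) : ∀ (v : F) (m : ℕ) (I : Idx),
    D.act m I (bv 0 L v) ∈ gr F ((L.card : ℤ) + 2 - 2 * (m : ℤ) - (I.card : ℤ)) := by
  induction L using Finset.induction_on with
  | empty =>
    intro v m I
    by_cases h : 2 < 2 * m + I.card
    · rw [hD.vac_pos v m I h]; exact Submodule.zero_mem _
    · obtain rfl | rfl : m = 0 ∨ m = 1 := by omega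
      · have hc : I.card = 0 ∨ I.card = 1 ∨ I.card = 2 := by omega
        rcases hc with hc | hc | hc
        · rw [Finset.card_eq_zero] at hc
          subst hc
          rw [hD.low_one]
          exact Submodule.smul_mem _ _ (bv_mem_gr _ _ _ _ (by simp))
        · obtain ⟨i, rfl⟩ := Finset.card_eq_one.1 hc
          rw [hD.low_eta]
          simp only [Finset.notMem_empty, if_false]
          exact Submodule.smul_mem _ _ (bv_mem_gr _ _ _ _ (by simp))
        · obtain ⟨i, j, hij, rfl⟩ := Finset.card_eq_two.1 hc
          rcases lt_or_gt_of_ne hij with h' | h'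
          · rw [hD.vac_xi v i j h']
            exact bv_mem_gr _ _ _ _ (by simp [hc])
          · rw [hc, Finset.pair_comm, hD.vac_xi v j i h']
            exact bv_mem_gr _ _ _ _ (by simp)
      · have hc : I = ∅ := by rw [← Finset.card_eq_zero]; omega
        subst hc
        rw [hD.vac_t]
        exact bv_mem_gr _ _ _ _ (by simp)
  | insert i L hi ih =>
    intro v m I
    have hb : bv 0 (insert i L) v = ((msign {i} L : ℤ) : ℂ) • D.act 0 {i} (bv 0 L v) := by
      rw [hD.low_eta, if_neg hi, smul_smul, msign_min, one_smul]
    rw [hb, map_smul]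
    refine Submodule.smul_mem _ _ ?_
    have hl := LinearMap.congr_fun (hD.lie m I 0 {i}) (bv 0 L v)
    simp only [LinearMap.sub_apply, LinearMap.smul_apply, LinearMap.comp_apply] at hl
    rw [sub_eq_iff_eq_add] at hl
    rw [hl, Finset.card_insert_of_notMem hi]
    refine Submodule.add_mem _ ?_ (Submodule.smul_mem _ _ ?_)
    · unfold brkAct
      simp only [LinearMap.add_apply, LinearMap.smul_apply, LinearMap.sum_apply]
      refine Submodule.add_mem _ (Submodule.add_mem _ ?_ ?_) ?_
      · rcases Nat.eq_zero_or_pos m with rfl | hm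
        · simp
        · refine Submodule.smul_mem _ _ ?_
          split_ifs with hd
          · rw [LinearMap.smul_apply]
            refine Submodule.smul_mem _ _ ?_
            convert ih v (m + 0 - 1) (I ∪ {i}) using 2
            rw [Finset.card_union_of_disjoint hd]
            simp only [Finset.card_singleton]
            omega
          · simp
      · refine Submodule.smul_mem _ _ (Submodule.sum_mem _ fun j _ => ?_)
        split_ifs with hd
        · rw [LinearMap.smul_apply]
          refine Submodule.smul_mem _ _ ?_
          obtain ⟨h1, h2, h3⟩ := hd
          obtain rfl := Finset.mem_singleton.1 h2
          convert ih v (m + 0) (I.erase j ∪ ({j} : Idx).erase j) using 2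
          have := Finset.card_erase_add_one h1
          rw [Finset.card_union_of_disjoint h3]
          simp only [Finset.erase_singleton, Finset.card_empty]
          omega
        · simp
      · split_ifs with hm
        · by_cases hp : psi0 I {i} = 0
          · simp [hp]
          · have hI := psi0_card I i hp
            refine Submodule.smul_mem _ _ ?_
            have : Cop D.ρC (bv 0 L v) = bv 0 L (D.ρC v) := by
              simp [Cop, bv]
            rw [this]
            refine bv_mem_gr _ _ _ _ ?_
            obtain ⟨rfl, -⟩ := hm
            rw [hI]
            push_cast
            omega
        · simp
    · have := act_eta_gr hD i _ _ (ih v m I)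
      convert this using 2
      push_cast
      ring

lemma act_one (hD : IsVerma D) : D.act 0 ∅ = (-2 : ℂ) • thOp := by
  apply bv_ext
  intro k L v
  rw [hD.low_one, LinearMap.smul_apply, thOp_bv]

/-- Commutation of `t^m ξ_i` with `Θ`. -/
lemma act_thOp (hD : IsVerma D) (i : Fin 4) (m : ℕ) (x : VInd F) :
    D.act m {i} (thOp x) = thOp (D.act m {i} x) + (m : ℂ) • D.act (m - 1) {i} x := by
  have hl := LinearMap.congr_fun (hD.lie m {i} 0 ∅) x
  have hs : msign {i} ∅ = 1 := by simp [msign]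
  simp only [act_one hD, brkAct, psi0_single_empty, hs, LinearMap.sub_apply, LinearMap.smul_apply,
    LinearMap.comp_apply, LinearMap.add_apply, map_smul, LinearMap.sum_apply] at hl
  simp at hl
  have h2 : (-2 : ℂ) • (D.act m {i} (thOp x)) = (-2 : ℂ) •
      (thOp (D.act m {i} x) + (m : ℂ) • D.act (m - 1) {i} x) := by
    rw [smul_add, smul_smul, neg_mul, neg_smul, neg_smul, neg_smul]
    rw [← hl]
    abel
  exact smul_right_injective _ (by norm_num : (-2 : ℂ) ≠ 0) h2

/-- The key identity: `∑ (-1)^j C(3,j) ∂^j (t^{3-j} ξ_i) = 0` on `Ind F`. -/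
lemma key (hD : IsVerma D) (i : Fin 4) (x : VInd F) :
    D.act 3 {i} x - (3 : ℂ) • dOp (D.act 2 {i} x) + (3 : ℂ) • dOp (dOp (D.act 1 {i} x))
      - dOp (dOp (dOp (D.act 0 {i} x))) = 0 := by
  let A : VInd F →ₗ[ℂ] VInd F := D.act 3 {i} - (3 : ℂ) • (dOp ∘ₗ D.act 2 {i})
    + (3 : ℂ) • (dOp ∘ₗ dOp ∘ₗ D.act 1 {i}) - dOp ∘ₗ dOp ∘ₗ dOp ∘ₗ D.act 0 {i}
  have hA : ∀ y, A y = D.act 3 {i} y - (3 : ℂ) • dOp (D.act 2 {i} y)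
      + (3 : ℂ) • dOp (dOp (D.act 1 {i} y)) - dOp (dOp (dOp (D.act 0 {i} y))) := fun y => rfl
  have hcomm : ∀ y, A (thOp y) = thOp (A y) := by
    intro y
    simp only [hA, act_thOp hD, map_add, map_sub, map_smul, dOp_thOp]
    push_cast
    module
  have h0 : A = 0 := by
    apply bv_ext
    intro k L v
    rw [LinearMap.zero_apply]
    induction k with
    | succ k ih => rw [← thOp_bv, hcomm, ih, map_zero]
    | zero =>
      have hL : L.card ≤ 4 := by simpa using Finset.card_le_univ L
      have g := act_gr hD L v
      have e3 : D.act 3 {i} (bv 0 L v) = 0 :=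
        gr_neg _ (by simp only [Finset.card_singleton]; push_cast; omega) _ (g 3 {i})
      have e2 : dOp (D.act 2 {i} (bv 0 L v)) = 0 :=
        dOp_thLe_zero _ (gr_le_thLe _ _
          (by simp only [Finset.card_singleton]; push_cast; omega) (g 2 {i}))
      have e1 : dOp (dOp (D.act 1 {i} (bv 0 L v))) = 0 :=
        dOp_thLe_zero _ (dOp_thLe_succ _ _ (gr_le_thLe _ _
          (by simp only [Finset.card_singleton]; push_cast; omega) (g 1 {i})))
      have e0 : dOp (dOp (dOp (D.act 0 {i} (bv 0 L v)))) = 0 :=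
        dOp_thLe_zero _ (dOp_thLe_succ _ _ (dOp_thLe_succ _ _ (gr_le_thLe _ _
          (by simp only [Finset.card_singleton]; push_cast; omega) (g 0 {i}))))
      rw [hA, e3, e2, e1, e0]
      simp
  rw [← hA, h0, LinearMap.zero_apply]

lemma eta_sq (hD : IsVerma D) (x : VInd F) :
    D.act 0 {0} (D.act 0 {0} x) = thOp x := by
  have : D.act 0 {0} ∘ₗ D.act 0 {0} = (thOp : VInd F →ₗ[ℂ] VInd F) := by
    apply bv_ext
    intro k L v
    rw [LinearMap.comp_apply, hD.low_eta, thOp_bv]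
    have hm : ∀ L : Idx, msign {0} L = 1 := by decide
    have hd : ∀ L : Idx, dsign 0 L = 1 := by decide
    split_ifs with h
    · rw [map_smul, hD.low_eta]
      simp [hm, hd, Finset.insert_erase h]
    · rw [map_smul, hD.low_eta]
      simp [hm, hd, Finset.erase_insert h]
  exact LinearMap.congr_fun this x

lemma eta_thLe (hD : IsVerma D) (i : Fin 4) (n : ℕ) (x : VInd F) (hx : x ∈ thLe F n) :
    D.act 0 {i} x ∈ thLe F (n + 1) := by
  refine supported_induction _ _ _ (fun k L v hk => ?_) x hx
  simp only [Set.mem_ofPred_eq] at hk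
  rw [hD.low_eta]
  split_ifs with h
  · exact Submodule.smul_mem _ _ (bv_mem_thLe _ _ _ _ (by omega))
  · exact Submodule.smul_mem _ _ (bv_mem_thLe _ _ _ _ (by omega))

lemma mem_thLe_iff (n : ℕ) (x : VInd F) :
    x ∈ thLe F n ↔ ∀ k L, n < k → x (k, L) = 0 := by
  rw [thLe, Finsupp.mem_supported']
  constructor
  · intro h k L hk
    exact h (k, L) (by simpa using hk)
  · rintro h ⟨k, L⟩ hk
    exact h k L (by simpa using hk)

/-- A singular vector has `Θ`-degree at most two. -/
lemma singular_thLe (hD : IsVerma D) (u : VInd F) (hu : IsSingular D u) : u ∈ thLe F 2 := by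
  have hk := key hD 0 u
  rw [hu.2 3 {0} (by simp), hu.2 2 {0} (by simp), hu.2 1 {0} (by simp)] at hk
  simp only [map_zero, smul_zero, sub_zero, add_zero, zero_sub, neg_eq_zero] at hk
  have h1 : D.act 0 {0} u ∈ thLe F 2 := by
    rw [mem_thLe_iff]
    intro k L hkk
    obtain ⟨n, rfl⟩ : ∃ n, k = n + 3 := ⟨k - 3, by omega⟩
    have h := DFunLike.congr_fun hk (n, L)
    rw [dOp_apply, dOp_apply, dOp_apply, Finsupp.zero_apply] at h
    have c : ∀ n : ℕ, (n : ℂ) + 1 ≠ 0 := fun n => Nat.cast_add_one_ne_zero n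
    rw [smul_eq_zero_iff_right (c _), smul_eq_zero_iff_right (c _),
      smul_eq_zero_iff_right (c _)] at h
    exact h
  have h2 := eta_thLe hD 0 2 _ h1
  rw [eta_sq hD, mem_thLe_iff] at h2
  rw [mem_thLe_iff]
  intro k L hkk
  rw [← thOp_apply]
  exact h2 _ _ (by omega)

lemma Tmap_thLe (n : ℕ) (x : VInd F) (hx : x ∈ thLe F n) : Tmap x ∈ thLe F n := by
  refine supported_induction _ _ _ (fun k L v hk => ?_) x hx
  simp only [Tmap, bv, Finsupp.lsum_single, LinearMap.smul_apply, Finsupp.lsingle_apply]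
  exact Submodule.smul_mem _ _ (bv_mem_thLe _ _ _ _ hk)

end helpers

/-- **The `Θ`-degree of a singular vector is at most 3** (Lemma `411`).
If `u ∈ Ind F` is a singular vector and `T(u) = ∑_{k,L} Θ^k η_L ⊗ v_{L,k}`, then
`v_{L,k} = 0` for all `k ≥ 4`. -/
theorem theta_degree_le_three
    (F : Type*) [AddCommGroup F] [Module ℂ F] [FiniteDimensional ℂ F]
    (D : VermaData F) (hD : IsVerma D) (hirr : IsIrred D)
    (u : VInd F) (hu : IsSingular D u) :
    ∀ (k : ℕ) (L : Idx), 4 ≤ k → Tmap u (k, L) = 0 := by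
  intro k L hk
  exact (mem_thLe_iff 2 _).1 (Tmap_thLe 2 u (singular_thLe hD u hu)) k L (by omega)
end

section
/- Let m⃗ ∈ Ind(F) be a singular vector over g = A(K'_4) with T(m⃗) = Σ_{k} Σ_L Θ^k η_L ⊗ v_{L,k}. Then v_{L,3} = 0 for all L, v_{L,2} = 0 for all L, v_{L,1} = 0 for all L with |L| ≤ 2, and v_{∅,0} = 0; hence T(m⃗) = Θ Σ_{|L|≥3} η_L ⊗ v_{L,1} + Σ_{|L|≥1} η_L ⊗ v_{L,0}, and consequently every nontrivial singular vector has degree 1, 2 or 3. -/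
/-!
Core definitions modelling the annihilation superalgebra `𝔤 = 𝒜(K'₄) = K(1,4)₊ ⊕ ℂC`
and generalized Verma modules `Ind F ≅ ℂ[Θ] ⊗ Λ(η₁,…,η₄) ⊗ F` over it.

Grassmann monomials `ξ_I`/`η_I` (with `I` in increasing order) are indexed by
`Idx = Finset (Fin 4)`.
-/

open Finset

section helpers
variable {F : Type*} [AddCommGroup F] [Module ℂ F]

lemma psi0_zero {I J : Idx} (h : J ≠ Iᶜ) : psi0 I J = 0 := by
  unfold psi0
  have h1 : ¬ (I = (∅ : Idx) ∧ J = (Finset.univ : Idx)) := by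
    rintro ⟨rfl, rfl⟩; exact h (by decide)
  have h2 : ¬ (I = (Finset.univ : Idx) ∧ J = (∅ : Idx)) := by
    rintro ⟨rfl, rfl⟩; exact h (by decide)
  have h3 : ∀ i : Fin 4, ¬ (I = ({i} : Idx) ∧ J = ({i}ᶜ : Idx)) := by
    rintro i ⟨rfl, rfl⟩; exact h rfl
  have h4 : ∀ i : Fin 4, ¬ (I = ({i}ᶜ : Idx) ∧ J = ({i} : Idx)) := by
    rintro i ⟨rfl, rfl⟩; exact h (by simp)
  simp [h1, h2, h3, h4]

/-- The submodule of vectors of degree `e`. -/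
noncomputable def Hd (F : Type*) [AddCommGroup F] [Module ℂ F] (e : ℤ) : Submodule ℂ (VInd F) :=
  Finsupp.supported F ℂ {p : ℕ × Idx | (2 * (p.1 : ℤ) + p.2.card) = e}

lemma bv_mem (k : ℕ) (L : Idx) (v : F) (e : ℤ) (h : 2 * (k : ℤ) + L.card = e) :
    bv k L v ∈ Hd F e :=
  Finsupp.single_mem_supported ℂ v h

lemma Cop_mem (ρC : F →ₗ[ℂ] F) {e : ℤ} {w : VInd F} (hw : w ∈ Hd F e) :
    Cop ρC w ∈ Hd F e := by
  unfold Hd at *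
  rw [Finsupp.mem_supported'] at *
  intro p hp
  simp [Cop, hw p hp]

/-- A linear map that sends basis vectors to the right degree does so for all vectors. -/
lemma map_mem (A : VInd F →ₗ[ℂ] VInd F) (s : ℤ)
    (h : ∀ (k : ℕ) (L : Idx) (v : F), A (bv k L v) ∈ Hd F (2 * (k : ℤ) + L.card + s))
    {e : ℤ} {w : VInd F} (hw : w ∈ Hd F e) : A w ∈ Hd F (e + s) := by
  have : w = w.sum (fun p v => bv p.1 p.2 v) := (Finsupp.sum_single w).symm
  rw [this, Finsupp.sum, map_sum]
  refine Submodule.sum_mem _ fun p hp => ?_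
  have hp' : (2 * (p.1 : ℤ) + p.2.card) = e := hw hp
  rw [← hp']; exact h _ _ _

variable {D : VermaData F}

lemma eta_mem (hD : IsVerma D) (i : Fin 4) {e : ℤ} {w : VInd F} (hw : w ∈ Hd F e) :
    D.act 0 {i} w ∈ Hd F (e + 1) := by
  refine map_mem _ _ (fun k L v => ?_) hw
  rw [hD.low_eta]
  split_ifs with h
  · refine Submodule.smul_mem _ _ (bv_mem _ _ _ _ ?_)
    have := Finset.card_erase_add_one h
    push_cast; omega
  · refine Submodule.smul_mem _ _ (bv_mem _ _ _ _ ?_)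
    rw [Finset.card_insert_of_notMem h]; push_cast; ring

lemma one_mem' (hD : IsVerma D) {e : ℤ} {w : VInd F} (hw : w ∈ Hd F e) :
    D.act 0 ∅ w ∈ Hd F (e + 2) := by
  refine map_mem _ _ (fun k L v => ?_) hw
  rw [hD.low_one]
  refine Submodule.smul_mem _ _ (bv_mem _ _ _ _ ?_)
  push_cast; ring

/-- All of the superalgebra moves `w` to the expected degree. -/
def Good (D : VermaData F) (w : VInd F) (e : ℤ) : Prop :=
  w ∈ Hd F e ∧ ∀ (m : ℕ) (I : Idx), D.act m I w ∈ Hd F (e - (2 * (m : ℤ) + I.card - 2))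

lemma act_comm (hD : IsVerma D) (m : ℕ) (I : Idx) (n : ℕ) (J : Idx) (w : VInd F) :
    D.act m I (D.act n J w) = ((-1 : ℂ) ^ (I.card * J.card)) • D.act n J (D.act m I w)
      + brkAct D.ρC D.act m I n J w := by
  have := congrArg (fun f => f w) (hD.lie m I n J)
  simp only [LinearMap.sub_apply, LinearMap.comp_apply, LinearMap.smul_apply] at this
  rw [← this]; abel

lemma brk_mem {w : VInd F} {e : ℤ} (hw : Good D w e) (m : ℕ) (I J : Idx) :
    brkAct D.ρC D.act m I 0 J w
      ∈ Hd F (e - (2 * (m : ℤ) + I.card - 2) - ((J.card : ℤ) - 2)) := by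
  unfold brkAct
  simp only [LinearMap.add_apply, LinearMap.smul_apply]
  refine Submodule.add_mem _ (Submodule.add_mem _ ?_ ?_) ?_
  · rcases Nat.eq_zero_or_pos m with rfl | hm
    · simp
    · split_ifs with h
      · refine Submodule.smul_mem _ _ ?_
        rw [LinearMap.smul_apply]
        refine Submodule.smul_mem _ _ ?_
        convert hw.2 (m + 0 - 1) (I ∪ J) using 2
        rw [Finset.card_union_of_disjoint h]
        push_cast [Nat.cast_sub hm]; 
        omega
      · simp
  · refine Submodule.smul_mem _ _ ?_
    rw [LinearMap.sum_apply]
    refine Submodule.sum_mem _ fun i _ => ?_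
    split_ifs with h
    · rw [LinearMap.smul_apply]
      refine Submodule.smul_mem _ _ ?_
      convert hw.2 (m + 0) (I.erase i ∪ J.erase i) using 2
      rw [Finset.card_union_of_disjoint h.2.2]
      have h1 := Finset.card_erase_add_one h.1
      have h2 := Finset.card_erase_add_one h.2.1
      push_cast; omega
    · simp
  · by_cases hm : m = 0
    · by_cases hJ : J = Iᶜ
      · refine Submodule.smul_mem _ _ ?_
        convert Cop_mem D.ρC hw.1 using 2
        have := Finset.card_add_card_compl I
        rw [← hJ, Fintype.card_fin] at this
        subst hm
        push_cast; omega
      · simp [psi0_zero hJ]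
    · simp [hm]

lemma good_eta (hD : IsVerma D) (i : Fin 4) {w : VInd F} {e : ℤ} (hw : Good D w e) :
    Good D (D.act 0 {i} w) (e + 1) := by
  refine ⟨eta_mem hD i hw.1, fun m I => ?_⟩
  rw [act_comm hD]
  refine Submodule.add_mem _ (Submodule.smul_mem _ _ ?_) ?_
  · convert eta_mem hD i (hw.2 m I) using 2; ring
  · convert brk_mem hw m I {i} using 2; simp; ring

lemma good_one (hD : IsVerma D) {w : VInd F} {e : ℤ} (hw : Good D w e) :
    Good D (D.act 0 ∅ w) (e + 2) := by
  refine ⟨one_mem' hD hw.1, fun m I => ?_⟩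
  rw [act_comm hD]
  refine Submodule.add_mem _ (Submodule.smul_mem _ _ ?_) ?_
  · convert one_mem' hD (hw.2 m I) using 2; ring
  · convert brk_mem hw m I ∅ using 2; simp; ring

lemma good_smul {w : VInd F} {e : ℤ} (c : ℂ) (hw : Good D w e) : Good D (c • w) e :=
  ⟨Submodule.smul_mem _ _ hw.1, fun m I => by
    rw [map_smul]; exact Submodule.smul_mem _ _ (hw.2 m I)⟩

lemma good_vac (hD : IsVerma D) (v : F) : Good D (bv 0 ∅ v) 0 := by
  refine ⟨bv_mem _ _ _ _ (by simp), fun m I => ?_⟩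
  by_cases h : 2 < 2 * m + I.card
  · rw [hD.vac_pos v m I h]; exact Submodule.zero_mem _
  rcases Nat.eq_zero_or_pos m with rfl | hm
  · have hc : I.card = 0 ∨ I.card = 1 ∨ I.card = 2 := by omega
    rcases hc with hc | hc | hc
    · rw [Finset.card_eq_zero] at hc; subst hc
      convert one_mem' hD (bv_mem 0 ∅ v 0 (by simp)) using 2; simp
    · obtain ⟨i, rfl⟩ := Finset.card_eq_one.1 hc
      convert eta_mem hD i (bv_mem 0 ∅ v 0 (by simp)) using 2; simp
    · obtain ⟨i, j, hij, rfl⟩ := Finset.card_eq_two.1 hc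
      rcases lt_or_gt_of_ne hij with h' | h'
      · rw [hD.vac_xi v i j h']
        exact bv_mem _ _ _ _ (by simp [hc])
      · rw [Finset.pair_comm, hD.vac_xi v j i h']
        exact bv_mem _ _ _ _ (by rw [Finset.pair_comm, hc]; simp)
  · have hm1 : m = 1 := by omega
    subst hm1
    have : I = ∅ := by rw [← Finset.card_eq_zero]; omega
    subst this
    rw [hD.vac_t]
    exact bv_mem _ _ _ _ (by simp)

lemma bv_succ (hD : IsVerma D) (k : ℕ) (L : Idx) (v : F) :
    bv (k + 1) L v = (-(2 : ℂ)⁻¹) • D.act 0 ∅ (bv k L v) := by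
  rw [hD.low_one, smul_smul]; norm_num

lemma bv_insert (hD : IsVerma D) (k : ℕ) (L : Idx) (i : Fin 4) (hi : i ∉ L) (v : F) :
    bv k (insert i L) v = ((msign {i} L : ℤ) : ℂ) • D.act 0 {i} (bv k L v) := by
  rw [hD.low_eta, if_neg hi, smul_smul]
  have : ((msign {i} L : ℤ) : ℂ) * ((msign {i} L : ℤ) : ℂ) = 1 := by
    unfold msign
    push_cast
    rw [← pow_add, ← two_mul, pow_mul]; simp
  rw [this, one_smul]

lemma good_bv (hD : IsVerma D) (k : ℕ) (L : Idx) (v : F) :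
    Good D (bv k L v) (2 * (k : ℤ) + L.card) := by
  induction k with
  | zero =>
    induction L using Finset.induction_on with
    | empty => simpa using good_vac hD v
    | insert i L hi ih =>
      rw [bv_insert hD _ _ _ hi, Finset.card_insert_of_notMem hi]
      convert good_smul _ (good_eta hD i ih) using 1
      push_cast; ring
  | succ k ih =>
    rw [bv_succ hD]
    convert good_smul _ (good_one hD ih) using 1
    push_cast; ring

/-- Degree bookkeeping. -/
lemma act_deg (hD : IsVerma D) (m : ℕ) (I : Idx) (p q : ℕ × Idx) (v : F)
    (h : 2 * q.1 + q.2.card + (2 * m + I.card) ≠ 2 * p.1 + p.2.card + 2) :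
    D.act m I (bv p.1 p.2 v) q = 0 := by
  have h1 := (good_bv hD p.1 p.2 v).2 m I
  unfold Hd at h1
  rw [Finsupp.mem_supported'] at h1
  apply h1
  simp only [Set.mem_ofPred_eq]
  omega

/-- Multiplication by `Θ^k`. -/
noncomputable def sh (k : ℕ) : VInd F →ₗ[ℂ] VInd F := Finsupp.lmapDomain F ℂ (fun p => (p.1 + k, p.2))

lemma sh_bv (j k : ℕ) (L : Idx) (v : F) : sh j (bv k L v) = bv (k + j) L v := by
  simp [sh, bv]

lemma sh_apply (k a : ℕ) (L : Idx) (w : VInd F) : sh k w (a + k, L) = w (a, L) := by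
  unfold sh
  exact Finsupp.mapDomain_apply (f := fun p : ℕ × Idx => (p.1 + k, p.2))
    (by rintro ⟨a, b⟩ ⟨c, d⟩ h; simpa using h) w (a, L)

lemma sh_low (k a : ℕ) (L : Idx) (w : VInd F) (h : a < k) : sh k w (a, L) = 0 := by
  unfold sh
  refine Finsupp.mapDomain_of_notMem_range (f := fun p : ℕ × Idx => (p.1 + k, p.2)) w (a, L) ?_
  rintro ⟨⟨x, y⟩, hxy⟩
  simp at hxy; omega

lemma one_eq (hD : IsVerma D) (w : VInd F) : D.act 0 ∅ w = (-2 : ℂ) • sh 1 w := by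
  have : D.act 0 ∅ = (-2 : ℂ) • sh 1 := by
    refine Finsupp.lhom_ext fun p v => ?_
    exact (hD.low_one v p.1 p.2).trans (by rw [LinearMap.smul_apply]; exact congrArg _ (sh_bv 1 p.1 p.2 v).symm)
  rw [this]; rfl

lemma sh_sh (j k : ℕ) (w : VInd F) : sh j (sh k w) = sh (k + j) w := by
  have : (sh j ∘ₗ sh k : VInd F →ₗ[ℂ] VInd F) = sh (k + j) := by
    refine Finsupp.lhom_ext fun p v => ?_
    change sh j (sh k (bv p.1 p.2 v)) = sh (k+j) (bv p.1 p.2 v)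
    rw [sh_bv, sh_bv, sh_bv, add_assoc]
  rw [← this]; rfl

lemma sh_comm_xi (hD : IsVerma D) (I : Idx) (hI : I.card = 3) (w : VInd F) :
    D.act 0 I (sh 1 w) = sh 1 (D.act 0 I w) := by
  have h := act_comm hD 0 I 0 ∅ w
  have hb : brkAct D.ρC D.act 0 I 0 ∅ = 0 := by
    have : psi0 I ∅ = 0 := psi0_zero (fun h => by
      have := Finset.card_add_card_compl I
      rw [← h, hI] at this; simp at this)
    simp [brkAct, this]
  rw [hb, one_eq hD, one_eq hD] at h
  simpa using h

lemma xi_bv (hD : IsVerma D) (I : Idx) (hI : I.card = 3) (k : ℕ) (L : Idx) (v : F) :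
    D.act 0 I (bv k L v) = sh k (D.act 0 I (bv 0 L v)) := by
  induction k with
  | zero =>
    have : (sh 0 : VInd F →ₗ[ℂ] VInd F) = LinearMap.id := by
      refine Finsupp.lhom_ext fun p v => sh_bv 0 p.1 p.2 v
    rw [this]; rfl
  | succ k ih =>
    rw [← sh_bv, sh_comm_xi hD I hI, ih, sh_sh]

lemma sh_comm_t (hD : IsVerma D) (i : Fin 4) (w : VInd F) :
    D.act 1 {i} (sh 1 w) = sh 1 (D.act 1 {i} w) + D.act 0 {i} w := by
  have h := act_comm hD 1 {i} 0 ∅ w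
  have hb : brkAct D.ρC D.act 1 {i} 0 ∅ = (-2 : ℂ) • D.act 0 {i} := by
    simp [brkAct, msign]
  rw [hb, one_eq hD, one_eq hD] at h
  rw [map_smul, LinearMap.smul_apply] at h
  simp only [Finset.card_empty, mul_zero, pow_zero, one_smul, ← smul_add] at h
  exact smul_right_injective _ (by norm_num : (-2 : ℂ) ≠ 0) h

lemma eta_sh (hD : IsVerma D) (i : Fin 4) (k : ℕ) (L : Idx) (v : F) :
    D.act 0 {i} (bv k L v) = sh k (D.act 0 {i} (bv 0 L v)) := by
  rw [hD.low_eta, hD.low_eta]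
  split_ifs <;> simp [sh_bv, add_comm]

lemma t_bv (hD : IsVerma D) (i : Fin 4) (k : ℕ) (L : Idx) (v : F) :
    D.act 1 {i} (bv k L v) =
      (k : ℂ) • D.act 0 {i} (bv (k - 1) L v) + sh k (D.act 1 {i} (bv 0 L v)) := by
  induction k with
  | zero =>
    have : (sh 0 : VInd F →ₗ[ℂ] VInd F) = LinearMap.id := by
      refine Finsupp.lhom_ext fun p v => sh_bv 0 p.1 p.2 v
    rw [this]; simp
  | succ k ih =>
    rw [← sh_bv, sh_comm_t hD, ih, map_add, map_smul, sh_sh]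
    rcases Nat.eq_zero_or_pos k with rfl | hk
    · simp; abel
    · obtain ⟨j, rfl⟩ : ∃ j, k = j + 1 := ⟨k - 1, by omega⟩
      have : sh 1 (D.act 0 {i} (bv (j + 1 - 1) L v)) = D.act 0 {i} (bv (j + 1) L v) := by
        rw [eta_sh hD, eta_sh hD i (j+1), sh_sh]; rfl
      rw [this]
      simp only [Nat.add_sub_cancel]
      push_cast
      module

/-- Only one coefficient contributes. -/
lemma comp_single (A : VInd F →ₗ[ℂ] VInd F) (u : VInd F) (p q : ℕ × Idx)
    (h : ∀ p', p' ≠ p → A (bv p'.1 p'.2 (u p')) q = 0) :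
    A u q = A (bv p.1 p.2 (u p)) q := by
  have h1 : A u = ∑ p' ∈ insert p u.support, A (bv p'.1 p'.2 (u p')) := by
    conv_lhs => rw [← Finsupp.sum_single u]
    rw [Finsupp.sum_of_support_subset u (s := insert p u.support) (Finset.subset_insert _ _) _ (by simp), map_sum]
    rfl
  rw [h1, Finsupp.finsetSum_apply]
  exact Finset.sum_eq_single_of_mem p (Finset.mem_insert_self _ _) (fun b _ hb => h b hb)
set_option linter.unusedSimpArgs false
set_option linter.unusedSectionVars false


lemma bv_apply (k k' : ℕ) (L L' : Idx) (v : F) :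
    bv k L v (k', L') = if k = k' ∧ L = L' then v else 0 := by
  simp [bv, Finsupp.single_apply]

lemma xi_in (hD : IsVerma D) (I I' : Idx) (l : Fin 4) (e s : ℤ) (hl : l ∈ I)
    (he : I.erase l = I') (hc : (-1) ^ I.card = e) (hs : dsign l I = s)
    (w : VInd F) :
    D.act 0 I (D.act 0 {l} w) = (e : ℂ) • D.act 0 {l} (D.act 0 I w)
      + ((e * s : ℤ) : ℂ) • D.act 0 I' w := by
  rw [act_comm hD]
  have h0 : psi0 I {l} = 0 := psi0_zero (fun h => by
    have : l ∈ Iᶜ := by rw [← h]; simp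
    simp [hl] at this)
  have hl1 : dsign l {l} = 1 := by simp [dsign, Finset.filter_singleton]
  have hm : msign (I.erase l) ∅ = 1 := by simp [msign]
  subst he hc hs
  simp only [brkAct, h0, Finset.mem_singleton]
  have : ∀ i : Fin 4, (i ∈ I ∧ i = l ∧ Disjoint (I.erase i) (({l} : Idx).erase i)) ↔ i = l := by
    intro i; constructor
    · rintro ⟨_, h, _⟩; exact h
    · rintro rfl; simp [hl]
  simp [this, hl1, hm, mul_smul]

lemma xi_out (hD : IsVerma D) (I : Idx) (l : Fin 4) (e : ℤ) (hl : l ∉ I)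
    (hc : (-1) ^ I.card = e) (w : VInd F) :
    D.act 0 I (D.act 0 {l} w) = (e : ℂ) • D.act 0 {l} (D.act 0 I w)
      + psi0 I {l} • Cop D.ρC w := by
  rw [act_comm hD]
  subst hc
  simp only [brkAct, Finset.mem_singleton]
  have : ∀ i : Fin 4, ¬ (i ∈ I ∧ i = l ∧ Disjoint (I.erase i) (({l} : Idx).erase i)) := by
    rintro i ⟨h, rfl, _⟩; exact hl h
  simp [this]

lemma txi_in (hD : IsVerma D) (i : Fin 4) (w : VInd F) :
    D.act 1 {i} (D.act 0 {i} w) = - D.act 0 {i} (D.act 1 {i} w) - D.act 1 ∅ w := by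
  rw [act_comm hD]
  have hl1 : dsign i {i} = 1 := by simp [dsign, Finset.filter_singleton]
  have hm : msign ∅ ∅ = 1 := by simp [msign]
  have : ∀ j : Fin 4, (j = i ∧ j = i ∧ Disjoint (({i} : Idx).erase j) (({i} : Idx).erase j)) ↔ j = i := by
    intro j; constructor
    · rintro ⟨_, h, _⟩; exact h
    · rintro rfl; simp
  simp only [brkAct, Finset.mem_singleton, this]
  simp [hl1, hm, sub_eq_add_neg]

lemma txi_out (hD : IsVerma D) (i l : Fin 4) (I' : Idx) (s : ℤ) (hl : i ≠ l) (hI : {i, l} = I')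
    (hs : msign {i} {l} = s) (w : VInd F) :
    D.act 1 {i} (D.act 0 {l} w) = - D.act 0 {l} (D.act 1 {i} w) - (s : ℂ) • D.act 0 I' w := by
  rw [act_comm hD]
  subst hI hs
  have : ∀ j : Fin 4, ¬ (j = i ∧ j = l ∧ Disjoint (({i} : Idx).erase j) (({l} : Idx).erase j)) := by
    rintro j ⟨rfl, h, _⟩; exact hl h
  have h2 : ({i} : Idx) ∪ {l} = {i, l} := rfl
  have h3 : (-2 + 1 : ℂ) = -1 := by norm_num
  simp only [brkAct, Finset.mem_singleton, this, Finset.disjoint_singleton, if_pos hl, h2]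
  simp [h3, sub_eq_add_neg]

lemma t_eta (hD : IsVerma D) (l : Fin 4) (w : VInd F) :
    D.act 1 ∅ (D.act 0 {l} w) = D.act 0 {l} (D.act 1 ∅ w) - D.act 0 {l} w := by
  rw [act_comm hD]
  have h3 : (-2 + 1 : ℂ) = -1 := by norm_num
  simp [brkAct, msign, h3, sub_eq_add_neg]

lemma bv_univ (hD : IsVerma D) (v : F) :
    bv 0 Finset.univ v = D.act 0 {0} (D.act 0 {1} (D.act 0 {2} (D.act 0 {3} (bv 0 ∅ v)))) := by
  have h3 : D.act 0 {3} (bv 0 ∅ v) = bv 0 {3} v := by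
    rw [hD.low_eta, if_neg (by decide), show msign {3} ∅ = 1 by decide]; simp
  have h2 : D.act 0 {2} (bv 0 {3} v) = bv 0 {2, 3} v := by
    rw [hD.low_eta, if_neg (by decide), show msign {2} {3} = 1 by decide]; simp
  have h1 : D.act 0 {1} (bv 0 {2, 3} v) = bv 0 {1, 2, 3} v := by
    rw [hD.low_eta, if_neg (by decide), show msign {1} {2, 3} = 1 by decide]; simp
  rw [h3, h2, h1, hD.low_eta, if_neg (by decide), show msign {0} {1, 2, 3} = 1 by decide]
  simp; rfl

lemma Cop_bv (ρC : F →ₗ[ℂ] F) (k : ℕ) (L : Idx) (v : F) : Cop ρC (bv k L v) = bv k L (ρC v) := by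
  simp [Cop, bv]

lemma xi2_out (hD : IsVerma D) (I : Idx) (l : Fin 4) (hl : l ∉ I)
    (hc : I.card = 2) (w : VInd F) :
    D.act 0 I (D.act 0 {l} w) = D.act 0 {l} (D.act 0 I w) := by
  rw [xi_out hD I l 1 hl (by rw [hc]; norm_num), psi0_zero]
  · simp
  · intro h
    have := Finset.card_add_card_compl I
    rw [← h, hc] at this; simp at this

lemma xi012 (hD : IsVerma D) (v : F) :
    D.act 0 {0, 1, 2} (bv 0 Finset.univ v) (0, {1, 2, 3}) = -D.ρξ 1 2 v ∧
    D.act 0 {0, 1, 2} (bv 0 Finset.univ v) (0, {0, 2, 3}) = -D.ρξ 0 2 v ∧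
    D.act 0 {0, 1, 2} (bv 0 Finset.univ v) (0, {0, 1, 3}) = -D.ρξ 0 1 v ∧
    (D.ρξ 1 2 v = 0 → D.ρξ 0 2 v = 0 → D.ρξ 0 1 v = 0 →
      D.act 0 {0, 1, 2} (bv 0 Finset.univ v) (1, {3}) = v) := by
  rw [bv_univ hD]
  have r0 := xi_in hD {0, 1, 2} {1, 2} 0 (-1) 1 (by decide) (by decide) (by decide) (by decide)
  have r1 := xi_in hD {0, 1, 2} {0, 2} 1 (-1) (-1) (by decide) (by decide) (by decide) (by decide)
  have r2 := xi_in hD {0, 1, 2} {0, 1} 2 (-1) 1 (by decide) (by decide) (by decide) (by decide)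
  have r3 := xi_out hD {0, 1, 2} 3 (-1) (by decide) (by decide)
  have p013 := xi2_out hD {0, 1} 3 (by decide) (by decide)
  have v01 := hD.vac_xi v 0 1 (by decide)
  have p022 := xi_in hD {0, 2} {0} 2 1 (-1) (by decide) (by decide) (by decide) (by decide)
  have p023 := xi2_out hD {0, 2} 3 (by decide) (by decide)
  have v02 := hD.vac_xi v 0 2 (by decide)
  have p121 := xi_in hD {1, 2} {2} 1 1 1 (by decide) (by decide) (by decide) (by decide)
  have p122 := xi_in hD {1, 2} {1} 2 1 (-1) (by decide) (by decide) (by decide) (by decide)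
  have p123 := xi2_out hD {1, 2} 3 (by decide) (by decide)
  have v12 := hD.vac_xi v 1 2 (by decide)
  have vT := hD.vac_pos v 0 {0, 1, 2} (by decide)
  simp only [r0, r1, r2, r3, p013, v01, p022, p023, v02, p121, p122, p123, v12, vT, map_add, map_sub, map_neg, map_smul, zero_smul, add_zero, smul_zero,
    map_zero, zero_add, Cop_bv]
  refine ⟨?_, ?_, ?_, fun h1 h2 h3 => ?_⟩
  all_goals simp +decide [hD.low_eta, bv_apply, Cop_bv, msign, dsign, Finset.filter_insert,
    Finset.filter_singleton, Finset.product_singleton]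

lemma xi013 (hD : IsVerma D) (v : F) :
    D.act 0 {0, 1, 3} (bv 0 Finset.univ v) (0, {1, 2, 3}) = -D.ρξ 1 3 v ∧
    D.act 0 {0, 1, 3} (bv 0 Finset.univ v) (0, {0, 2, 3}) = -D.ρξ 0 3 v := by
  rw [bv_univ hD]
  have r0 := xi_in hD {0, 1, 3} {1, 3} 0 (-1) 1 (by decide) (by decide) (by decide) (by decide)
  have r1 := xi_in hD {0, 1, 3} {0, 3} 1 (-1) (-1) (by decide) (by decide) (by decide) (by decide)
  have r2 := xi_out hD {0, 1, 3} 2 (-1) (by decide) (by decide)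
  have r3 := xi_in hD {0, 1, 3} {0, 1} 3 (-1) 1 (by decide) (by decide) (by decide) (by decide)
  have v01 := hD.vac_xi v 0 1 (by decide)
  have p032 := xi2_out hD {0, 3} 2 (by decide) (by decide)
  have p033 := xi_in hD {0, 3} {0} 3 1 (-1) (by decide) (by decide) (by decide) (by decide)
  have v03 := hD.vac_xi v 0 3 (by decide)
  have p131 := xi_in hD {1, 3} {3} 1 1 1 (by decide) (by decide) (by decide) (by decide)
  have p132 := xi2_out hD {1, 3} 2 (by decide) (by decide)
  have p133 := xi_in hD {1, 3} {1} 3 1 (-1) (by decide) (by decide) (by decide) (by decide)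
  have v13 := hD.vac_xi v 1 3 (by decide)
  have vT := hD.vac_pos v 0 {0, 1, 3} (by decide)
  simp only [r0, r1, r2, r3, v01, p032, p033, v03, p131, p132, p133, v13, vT, map_add, map_sub, map_neg, map_smul, zero_smul, add_zero, smul_zero,
    map_zero, zero_add, Cop_bv]
  refine ⟨?_, ?_⟩
  all_goals simp +decide [hD.low_eta, bv_apply, Cop_bv, msign, dsign, Finset.filter_insert,
    Finset.filter_singleton, Finset.product_singleton]

lemma xi023 (hD : IsVerma D) (v : F) :
    D.act 0 {0, 2, 3} (bv 0 Finset.univ v) (0, {1, 2, 3}) = -D.ρξ 2 3 v := by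
  rw [bv_univ hD]
  have r0 := xi_in hD {0, 2, 3} {2, 3} 0 (-1) 1 (by decide) (by decide) (by decide) (by decide)
  have r1 := xi_out hD {0, 2, 3} 1 (-1) (by decide) (by decide)
  have r2 := xi_in hD {0, 2, 3} {0, 3} 2 (-1) (-1) (by decide) (by decide) (by decide) (by decide)
  have r3 := xi_in hD {0, 2, 3} {0, 2} 3 (-1) 1 (by decide) (by decide) (by decide) (by decide)
  have v02 := hD.vac_xi v 0 2 (by decide)
  have p033 := xi_in hD {0, 3} {0} 3 1 (-1) (by decide) (by decide) (by decide) (by decide)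
  have v03 := hD.vac_xi v 0 3 (by decide)
  have p231 := xi2_out hD {2, 3} 1 (by decide) (by decide)
  have p232 := xi_in hD {2, 3} {3} 2 1 1 (by decide) (by decide) (by decide) (by decide)
  have p233 := xi_in hD {2, 3} {2} 3 1 (-1) (by decide) (by decide) (by decide) (by decide)
  have v23 := hD.vac_xi v 2 3 (by decide)
  have vT := hD.vac_pos v 0 {0, 2, 3} (by decide)
  simp only [r0, r1, r2, r3, v02, p033, v03, p231, p232, p233, v23, vT, map_add, map_sub, map_neg, map_smul, zero_smul, add_zero, smul_zero,
    map_zero, zero_add, Cop_bv]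
  simp +decide [hD.low_eta, bv_apply, Cop_bv, msign, dsign, Finset.filter_insert,
    Finset.filter_singleton, Finset.product_singleton]

lemma txi0 (hD : IsVerma D) (v : F) (h : ∀ i j : Fin 4, i < j → D.ρξ i j v = 0) :
    D.act 1 {0} (bv 0 Finset.univ v) (0, {0, 1, 2}) = 0 ∧
    D.act 1 {0} (bv 0 Finset.univ v) (0, {0, 1, 3}) = 0 ∧
    D.act 1 {0} (bv 0 Finset.univ v) (0, {0, 2, 3}) = 0 := by
  rw [bv_univ hD]
  have t0 := t_eta hD 0
  have t1 := t_eta hD 1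
  have t2 := t_eta hD 2
  have t3 := t_eta hD 3
  have tt := hD.vac_t v
  have r0 := txi_in hD 0
  have r1 := txi_out hD 0 1 {0, 1} 1 (by decide) (by decide) (by decide)
  have p012 := xi2_out hD {0, 1} 2 (by decide) (by decide)
  have p013 := xi2_out hD {0, 1} 3 (by decide) (by decide)
  have v01 := hD.vac_xi v 0 1 (by decide)
  have r2 := txi_out hD 0 2 {0, 2} 1 (by decide) (by decide) (by decide)
  have p023 := xi2_out hD {0, 2} 3 (by decide) (by decide)
  have v02 := hD.vac_xi v 0 2 (by decide)
  have r3 := txi_out hD 0 3 {0, 3} 1 (by decide) (by decide) (by decide)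
  have v03 := hD.vac_xi v 0 3 (by decide)
  have vT := hD.vac_pos v 1 {0} (by decide)
  simp only [t0, t1, t2, t3, tt, r0, r1, p012, p013, v01, r2, p023, v02, r3, v03, vT, map_add, map_sub, map_neg, map_smul, zero_smul, add_zero, smul_zero,
    map_zero, zero_add, Cop_bv]
  refine ⟨?_, ?_, ?_⟩
  all_goals simp +decide [hD.low_eta, bv_apply, Cop_bv, msign, dsign, Finset.filter_insert,
    Finset.filter_singleton, Finset.product_singleton, h]

lemma txi1 (hD : IsVerma D) (v : F) (h : ∀ i j : Fin 4, i < j → D.ρξ i j v = 0) :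
    D.act 1 {1} (bv 0 Finset.univ v) (0, {0, 1, 2}) = 0 ∧
    D.act 1 {1} (bv 0 Finset.univ v) (0, {0, 1, 3}) = 0 ∧
    D.act 1 {1} (bv 0 Finset.univ v) (0, {1, 2, 3}) = 0 := by
  rw [bv_univ hD]
  have t0 := t_eta hD 0
  have t1 := t_eta hD 1
  have t2 := t_eta hD 2
  have t3 := t_eta hD 3
  have tt := hD.vac_t v
  have r0 := txi_out hD 1 0 {0, 1} (-1) (by decide) (by decide) (by decide)
  have p011 := xi_in hD {0, 1} {0} 1 1 (-1) (by decide) (by decide) (by decide) (by decide)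
  have p012 := xi2_out hD {0, 1} 2 (by decide) (by decide)
  have p013 := xi2_out hD {0, 1} 3 (by decide) (by decide)
  have v01 := hD.vac_xi v 0 1 (by decide)
  have r1 := txi_in hD 1
  have r2 := txi_out hD 1 2 {1, 2} 1 (by decide) (by decide) (by decide)
  have p123 := xi2_out hD {1, 2} 3 (by decide) (by decide)
  have v12 := hD.vac_xi v 1 2 (by decide)
  have r3 := txi_out hD 1 3 {1, 3} 1 (by decide) (by decide) (by decide)
  have v13 := hD.vac_xi v 1 3 (by decide)
  have vT := hD.vac_pos v 1 {1} (by decide)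
  simp only [t0, t1, t2, t3, tt, r0, p011, p012, p013, v01, r1, r2, p123, v12, r3, v13, vT, map_add, map_sub, map_neg, map_smul, zero_smul, add_zero, smul_zero,
    map_zero, zero_add, Cop_bv]
  refine ⟨?_, ?_, ?_⟩
  all_goals simp +decide [hD.low_eta, bv_apply, Cop_bv, msign, dsign, Finset.filter_insert,
    Finset.filter_singleton, Finset.product_singleton, h]

lemma txi2 (hD : IsVerma D) (v : F) (h : ∀ i j : Fin 4, i < j → D.ρξ i j v = 0) :
    D.act 1 {2} (bv 0 Finset.univ v) (0, {0, 1, 2}) = 0 ∧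
    D.act 1 {2} (bv 0 Finset.univ v) (0, {0, 2, 3}) = 0 ∧
    D.act 1 {2} (bv 0 Finset.univ v) (0, {1, 2, 3}) = 0 := by
  rw [bv_univ hD]
  have t0 := t_eta hD 0
  have t1 := t_eta hD 1
  have t2 := t_eta hD 2
  have t3 := t_eta hD 3
  have tt := hD.vac_t v
  have r0 := txi_out hD 2 0 {0, 2} (-1) (by decide) (by decide) (by decide)
  have p021 := xi2_out hD {0, 2} 1 (by decide) (by decide)
  have p022 := xi_in hD {0, 2} {0} 2 1 (-1) (by decide) (by decide) (by decide) (by decide)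
  have p023 := xi2_out hD {0, 2} 3 (by decide) (by decide)
  have v02 := hD.vac_xi v 0 2 (by decide)
  have r1 := txi_out hD 2 1 {1, 2} (-1) (by decide) (by decide) (by decide)
  have p122 := xi_in hD {1, 2} {1} 2 1 (-1) (by decide) (by decide) (by decide) (by decide)
  have p123 := xi2_out hD {1, 2} 3 (by decide) (by decide)
  have v12 := hD.vac_xi v 1 2 (by decide)
  have r2 := txi_in hD 2
  have r3 := txi_out hD 2 3 {2, 3} 1 (by decide) (by decide) (by decide)
  have v23 := hD.vac_xi v 2 3 (by decide)
  have vT := hD.vac_pos v 1 {2} (by decide)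
  simp only [t0, t1, t2, t3, tt, r0, p021, p022, p023, v02, r1, p122, p123, v12, r2, r3, v23, vT, map_add, map_sub, map_neg, map_smul, zero_smul, add_zero, smul_zero,
    map_zero, zero_add, Cop_bv]
  refine ⟨?_, ?_, ?_⟩
  all_goals simp +decide [hD.low_eta, bv_apply, Cop_bv, msign, dsign, Finset.filter_insert,
    Finset.filter_singleton, Finset.product_singleton, h]

lemma t_high (hD : IsVerma D) (i : Fin 4) (L : Idx) (hi : i ∉ L) (k k' : ℕ) (L' : Idx) (v : F)
    (hne : (k', L') ≠ (k + 1, L)) (hk : k < k') :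
    D.act 1 {i} (bv k' L' v) (k, insert i L) = 0 := by
  rw [t_bv hD, Finsupp.add_apply, sh_low _ _ _ _ hk, Finsupp.smul_apply, hD.low_eta]
  split_ifs with h
  · rw [Finsupp.smul_apply, bv_apply, if_neg]
    · simp
    · rintro ⟨h1, -⟩; omega
  · rw [Finsupp.smul_apply, bv_apply, if_neg]
    · simp
    · rintro ⟨h1, h2⟩
      apply hne
      have : L' = L := by
        rw [← Finset.erase_insert h, h2, Finset.erase_insert hi]
      rw [this, show k' = k + 1 by omega]

lemma t_main (hD : IsVerma D) (i : Fin 4) (L : Idx) (hi : i ∉ L) (k : ℕ) (v : F)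
    (h : D.act 1 {i} (bv (k + 1) L v) (k, insert i L) = 0) : v = 0 := by
  rw [t_bv hD, Finsupp.add_apply, sh_low _ _ _ _ (Nat.lt_succ_self k), Finsupp.smul_apply,
    hD.low_eta, if_neg hi, Finsupp.smul_apply, bv_apply, if_pos (by simp), add_zero] at h
  rcases smul_eq_zero.1 h with h | h
  · exact absurd h (by exact_mod_cast Nat.succ_ne_zero k)
  · rcases smul_eq_zero.1 h with h | h
    · simp [msign] at h
    · exact h

lemma t_step (hD : IsVerma D) {u : VInd F} (hu : IsSingular D u) (i : Fin 4) (L : Idx)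
    (hi : i ∉ L) (k : ℕ)
    (h : ∀ (k' : ℕ) (L' : Idx), k' ≤ k → 2 * k' + L'.card = 2 * k + 2 + L.card →
      D.act 1 {i} (bv k' L' (u (k', L'))) (k, insert i L) = 0) :
    u (k + 1, L) = 0 := by
  apply t_main hD i L hi k
  have h0 : D.act 1 {i} u = 0 := hu.2 1 {i} (by simp)
  have h1 := comp_single (D.act 1 {i}) u (k + 1, L) (k, insert i L) (by
    rintro ⟨k', L'⟩ hne
    by_cases hk : k < k'
    · exact t_high hD i L hi k k' L' _ hne hk
    · by_cases hd : 2 * k' + L'.card = 2 * k + 2 + L.card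
      · exact h k' L' (by omega) hd
      · apply act_deg hD 1 {i} (k', L') (k, insert i L)
        rw [Finset.card_insert_of_notMem hi]
        simp only [Finset.card_singleton]
        omega)
  rw [h0] at h1
  exact h1.symm

lemma card_le4 (L : Idx) : L.card ≤ 4 := by
  simpa using Finset.card_le_univ L

lemma card4 {L : Idx} (h : L.card = 4) : L = Finset.univ := by
  rw [← Finset.card_eq_iff_eq_univ]; simpa using h

lemma exists_notMem {L : Idx} (h : L.card < 4) : ∃ i, i ∉ L := by
  by_contra! hc
  have : L = Finset.univ := Finset.eq_univ_iff_forall.2 hc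
  rw [this] at h; simp at h

lemma van3 (hD : IsVerma D) {u : VInd F} (hu : IsSingular D u) (k : ℕ) (L : Idx)
    (hL : L.card = 3) : u (k + 1, L) = 0 := by
  obtain ⟨i, hi⟩ := exists_notMem (show L.card < 4 by omega)
  refine t_step hD hu i L hi k fun k' L' h1 h2 => ?_
  have := card_le4 L'
  omega

lemma act_zero_of (A : VInd F →ₗ[ℂ] VInd F) (k : ℕ) (L : Idx) (q : ℕ × Idx) (v : F)
    (hv : v = 0) : A (bv k L v) q = 0 := by
  subst hv; simp [bv]

lemma van1 (hD : IsVerma D) {u : VInd F} (hu : IsSingular D u) (k : ℕ) (L : Idx)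
    (hL : L.card = 1) : u (k + 2, L) = 0 := by
  obtain ⟨i, hi⟩ := exists_notMem (show L.card < 4 by omega)
  refine t_step hD hu i L hi (k + 1) fun k' L' h1 h2 => ?_
  have := card_le4 L'
  have hk : k' = k + 1 := by omega
  subst hk
  exact act_zero_of _ _ _ _ _ (van3 hD hu k L' (by omega))

lemma xi_eq (hD : IsVerma D) {u : VInd F} (hu : IsSingular D u) (I S : Idx) (hI : I.card = 3)
    (hS : S.card = 3) (k : ℕ) :
    D.act 0 I (bv 0 Finset.univ (u (k, Finset.univ))) (0, S) = 0 := by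
  have h0 : D.act 0 I u = 0 := hu.2 0 I (by omega)
  have h1 := comp_single (D.act 0 I) u (k, Finset.univ) (k, S) (by
    rintro ⟨k', L'⟩ hne
    by_cases hk : k < k'
    · exact (congrArg (fun f => f (k, S)) (xi_bv hD I hI k' L' _)).trans (sh_low _ _ _ _ hk)
    · by_cases hd : 2 * k' + L'.card = 2 * k + 4
      · exfalso
        have := card_le4 L'
        have hL : L' = Finset.univ := card4 (by omega)
        have hk : k' = k := by omega
        exact hne (by rw [hL, hk])
      · apply act_deg hD 0 I (k', L') (k, S)
        simp only
        omega)
  rw [h0] at h1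
  simp only at h1
  rw [xi_bv hD I hI, show ((k, S) : ℕ × Idx) = (0 + k, S) by simp, sh_apply] at h1
  exact h1.symm

lemma rho_zero (hD : IsVerma D) {u : VInd F} (hu : IsSingular D u) (k : ℕ) :
    ∀ i j : Fin 4, i < j → D.ρξ i j (u (k, Finset.univ)) = 0 := by
  have e := fun I S hI hS => xi_eq hD hu I S hI hS k
  obtain ⟨a1, a2, a3, -⟩ := xi012 hD (u (k, Finset.univ))
  obtain ⟨b1, b2⟩ := xi013 hD (u (k, Finset.univ))
  have c1 := xi023 hD (u (k, Finset.univ))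
  rw [e _ _ (by decide) (by decide), eq_comm, neg_eq_zero] at a1 a2 a3 b1 b2 c1
  intro i j hij
  fin_cases i <;> fin_cases j <;> first | assumption | (exact absurd hij (by decide))

lemma van2_aux (hD : IsVerma D) {u : VInd F} (hu : IsSingular D u) (i : Fin 4) (L : Idx)
    (hi : i ∉ L) (hL : L.card = 2) (k : ℕ)
    (h : D.act 1 {i} (bv 0 Finset.univ (u (k, Finset.univ))) (0, insert i L) = 0) :
    u (k + 1, L) = 0 := by
  refine t_step hD hu i L hi k fun k' L' h1 h2 => ?_
  have := card_le4 L'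
  have hL' : L' = Finset.univ := card4 (by omega)
  have hk : k' = k := by omega
  subst hk hL'
  rw [t_bv hD, Finsupp.add_apply, show ((k', insert i L) : ℕ × Idx) = (0 + k', insert i L) by simp,
    sh_apply, h, hD.low_eta, if_pos (Finset.mem_univ i), Finsupp.smul_apply, Finsupp.smul_apply,
    bv_apply, if_neg]
  · simp
  · rintro ⟨-, h2⟩
    have : i ∈ insert i L := Finset.mem_insert_self _ _
    rw [← h2] at this
    simp at this

lemma van2 (hD : IsVerma D) {u : VInd F} (hu : IsSingular D u) (k : ℕ) (L : Idx)
    (hL : L.card = 2) : u (k + 1, L) = 0 := by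
  obtain ⟨a1, a2, a3⟩ := txi0 hD _ (rho_zero hD hu k)
  obtain ⟨b1, b2, b3⟩ := txi1 hD _ (rho_zero hD hu k)
  obtain ⟨c1, c2, c3⟩ := txi2 hD _ (rho_zero hD hu k)
  have key : ∀ L : Idx, L.card = 2 → L = {1, 2} ∨ L = {1, 3} ∨ L = {2, 3} ∨ L = {0, 2} ∨
      L = {0, 3} ∨ L = {0, 1} := by decide
  rcases key L hL with rfl | rfl | rfl | rfl | rfl | rfl
  · exact van2_aux hD hu 0 _ (by decide) hL k a1
  · exact van2_aux hD hu 0 _ (by decide) hL k a2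
  · exact van2_aux hD hu 0 _ (by decide) hL k a3
  · refine van2_aux hD hu 1 _ (by decide) hL k ?_
    rw [show (insert 1 {0, 2} : Idx) = {0, 1, 2} by decide]; exact b1
  · refine van2_aux hD hu 1 _ (by decide) hL k ?_
    rw [show (insert 1 {0, 3} : Idx) = {0, 1, 3} by decide]; exact b2
  · refine van2_aux hD hu 2 _ (by decide) hL k ?_
    rw [show (insert 2 {0, 1} : Idx) = {0, 1, 2} by decide]; exact c1

lemma van4 (hD : IsVerma D) {u : VInd F} (hu : IsSingular D u) (k : ℕ) :
    u (k, Finset.univ) = 0 := by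
  have hI : ({0, 1, 2} : Idx).card = 3 := by decide
  have h0 : D.act 0 {0, 1, 2} u = 0 := hu.2 0 _ (by decide)
  have h1 := comp_single (D.act 0 {0, 1, 2}) u (k, Finset.univ) (k + 1, {3}) (by
    rintro ⟨k', L'⟩ hne
    by_cases hk : k + 1 < k'
    · exact (congrArg (fun f => f (k + 1, {3})) (xi_bv hD _ hI k' L' _)).trans (sh_low _ _ _ _ hk)
    · by_cases hd : 2 * k' + L'.card = 2 * k + 4
      · have := card_le4 L'
        by_cases hk' : k' = k + 1
        · subst hk'
          exact act_zero_of _ _ _ _ _ (van2 hD hu k L' (by omega))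
        · have hL : L' = Finset.univ := card4 (by omega)
          have hk : k' = k := by omega
          exact absurd (by rw [hL, hk]) hne
      · apply act_deg hD 0 {0, 1, 2} (k', L') (k + 1, {3})
        simp only [hI, Finset.card_singleton]
        omega)
  rw [h0] at h1
  simp only at h1
  have r := rho_zero hD hu k
  rw [xi_bv hD _ hI, show ((k + 1, {3}) : ℕ × Idx) = (1 + k, {3}) by rw [add_comm], sh_apply,
    (xi012 hD _).2.2.2 (r 1 2 (by decide)) (r 0 2 (by decide)) (r 0 1 (by decide))] at h1
  exact h1.symm

lemma van0 (hD : IsVerma D) {u : VInd F} (hu : IsSingular D u) (k : ℕ) :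
    u (k + 2, ∅) = 0 := by
  refine t_step hD hu 0 ∅ (by decide) (k + 1) fun k' L' h1 h2 => ?_
  have := card_le4 L'
  rw [Finset.card_empty] at h2
  apply act_zero_of
  by_cases hk : k' = k + 1
  · subst hk
    exact van2 hD hu k L' (by omega)
  · rw [card4 (show L'.card = 4 by omega)]
    exact van4 hD hu k'

lemma van (hD : IsVerma D) {u : VInd F} (hu : IsSingular D u) (k : ℕ) (L : Idx)
    (h : 4 ≤ 2 * k + L.card) : u (k, L) = 0 := by
  have := card_le4 L
  have hc : L.card = 0 ∨ L.card = 1 ∨ L.card = 2 ∨ L.card = 3 ∨ L.card = 4 := by omega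
  rcases hc with hc | hc | hc | hc | hc
  · obtain ⟨j, rfl⟩ : ∃ j, k = j + 2 := ⟨k - 2, by omega⟩
    rw [Finset.card_eq_zero.1 hc]; exact van0 hD hu j
  · obtain ⟨j, rfl⟩ : ∃ j, k = j + 2 := ⟨k - 2, by omega⟩
    exact van1 hD hu j L hc
  · obtain ⟨j, rfl⟩ : ∃ j, k = j + 1 := ⟨k - 1, by omega⟩
    exact van2 hD hu j L hc
  · obtain ⟨j, rfl⟩ : ∃ j, k = j + 1 := ⟨k - 1, by omega⟩
    exact van3 hD hu j L hc
  · rw [card4 hc]; exact van4 hD hu k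

lemma Tmap_apply (u : VInd F) (k : ℕ) (L : Idx) :
    Tmap u (k, L) = ((msign L Lᶜ : ℤ) : ℂ) • u (k, Lᶜ) := by
  rw [comp_single Tmap u (k, Lᶜ) (k, L)]
  · simp [Tmap, bv]
  · rintro ⟨k', L'⟩ hne
    have : ¬ (k' = k ∧ L'ᶜ = L) := by
      rintro ⟨rfl, rfl⟩; simp at hne
    simp [Tmap, bv, Finsupp.single_apply, this]

end helpers

/-- **Shape of singular vectors** (Lemmas `lemmav3`, `lemmav2`, `lemmav1`).
Let `u ∈ Ind F` be a singular vector with `T(u) = ∑_{k,L} Θ^k η_L ⊗ v_{L,k}`.  Then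
`v_{L,k} = 0` for all `k ≥ 2`, `v_{L,1} = 0` for all `L` with `|L| ≤ 2`, and `v_{∅,0} = 0`;
hence `T(u) = Θ ∑_{|L|≥3} η_L ⊗ v_{L,1} + ∑_{|L|≥1} η_L ⊗ v_{L,0}`, and consequently every
nontrivial (homogeneous) singular vector has degree 1, 2 or 3. -/
theorem singular_vector_shape
    (F : Type*) [AddCommGroup F] [Module ℂ F] [FiniteDimensional ℂ F]
    (D : VermaData F) (hD : IsVerma D) (hirr : IsIrred D)
    (u : VInd F) (hu : IsSingular D u) :
    (∀ (k : ℕ) (L : Idx), 2 ≤ k → Tmap u (k, L) = 0) ∧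
    (∀ L : Idx, L.card ≤ 2 → Tmap u (1, L) = 0) ∧
    Tmap u (0, (∅ : Idx)) = 0 ∧
    (∀ d : ℕ, 0 < d → HomogDeg u d → d = 1 ∨ d = 2 ∨ d = 3) := by

  have hcc : ∀ L : Idx, L.card + Lᶜ.card = 4 := fun L => by
    simpa using Finset.card_add_card_compl L
  refine ⟨fun k L hk => ?_, fun L hL => ?_, ?_, fun d hd hh => ?_⟩
  · rw [Tmap_apply, van hD hu _ _ (by omega), smul_zero]
  · have := hcc L
    rw [Tmap_apply, van hD hu _ _ (by omega), smul_zero]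
  · rw [Tmap_apply, van hD hu _ _ (by simp), smul_zero]
  · obtain ⟨p, hp⟩ := Finsupp.support_nonempty_iff.2 hu.1
    have h1 := hh p hp
    by_contra hc
    exact Finsupp.mem_support_iff.1 hp (van hD hu p.1 p.2 (by omega))
end
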